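/- arXiv:1508.02962 — 2 statements merged into one kernel-verified Lean document; each statement's English description precedes it below -/
import Mathlib

section
/- Let F be a cone subequation on ℝⁿ, Ω ⊂ ℝⁿ a bounded domain, x₁,…,x_k ∈ Ω, φ ∈ C(∂Ω), and for each j let h_j be a downward-pointing singular F-harmonic of finite type at x_j. Let 𝔉 be the family of upper semicontinuous functions v on Ω̄ that are F-subharmonic on Ω, satisfy v ≤ φ on ∂Ω, and satisfy liminf_{x→x_j} (v(x) − v(x_j))/(h_j(x) − h_j(x_j)) ≥ 1 for each j. If H is continuous on Ω̄, F-harmonic on Ω ∖ {x₁,…,x_k}, equals φ on ∂Ω, and satisfies H ∼ h_j at each x_j, then H(x) = sup_{v ∈ 𝔉} v(x) for every x ∈ Ω̄. -/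
open scoped Topology Classical
open Filter

noncomputable section

/-- Euclidean space ℝⁿ. -/
abbrev EucSp (n : ℕ) := EuclideanSpace ℝ (Fin n)

/-- The space Sym²(ℝⁿ) of symmetric real n×n matrices, with its subspace topology. -/
abbrev SymMat (n : ℕ) := selfAdjoint (Matrix (Fin n) (Fin n) ℝ)

variable {n : ℕ}

/-- The matrix of the orthogonal projection onto the line ℝ·e (for a unit vector e). -/
def projMat (e : EucSp n) : Matrix (Fin n) (Fin n) ℝ := Matrix.of fun i j => e i * e j

lemma projMat_selfAdjoint (e : EucSp n) :
    projMat e ∈ selfAdjoint (Matrix (Fin n) (Fin n) ℝ) := by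
  rw [selfAdjoint.mem_iff]
  ext i j
  simp [projMat, Matrix.star_apply, mul_comm]

/-- P_e, the projection onto ℝ·e, as an element of Sym²(ℝⁿ). -/
def symProj (e : EucSp n) : SymMat n := ⟨projMat e, projMat_selfAdjoint e⟩

/-- The matrix P_{e⊥} − (p−1)·P_e. -/
def charMatM (p : ℝ) (e : EucSp n) : Matrix (Fin n) (Fin n) ℝ :=
  (1 - projMat e) - (p - 1) • projMat e

lemma charMatM_selfAdjoint (p : ℝ) (e : EucSp n) :
    charMatM p e ∈ selfAdjoint (Matrix (Fin n) (Fin n) ℝ) := by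
  have h := projMat_selfAdjoint e
  rw [selfAdjoint.mem_iff] at h ⊢
  simp [charMatM, star_sub, star_smul, star_one, h]

/-- P_{e⊥} − (p−1)·P_e as an element of Sym²(ℝⁿ). -/
def charMat (p : ℝ) (e : EucSp n) : SymMat n := ⟨charMatM p e, charMatM_selfAdjoint p e⟩

/-- A (constant coefficient, pure second order) cone subequation on ℝⁿ: a nonempty,
closed, proper subset of Sym²(ℝⁿ) satisfying positivity (F1) and the cone property (F2). -/
structure ConeSubequation (n : ℕ) where
  carrier : Set (SymMat n)
  nonempty' : carrier.Nonempty
  proper' : carrier ≠ Set.univ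
  isClosed' : IsClosed carrier
  f1 : ∀ A ∈ carrier, ∀ P : SymMat n, (P : Matrix (Fin n) (Fin n) ℝ).PosSemidef → A + P ∈ carrier
  f2 : ∀ A ∈ carrier, ∀ t : ℝ, 0 < t → t • A ∈ carrier

/-- The dual of a set of symmetric matrices: F̃ = {A : −A ∉ Int F}. -/
def dualSet (S : Set (SymMat n)) : Set (SymMat n) := {A | -A ∉ interior S}

/-- The subequation P = {A ≥ 0} of positive semidefinite matrices. -/
def PosP (n : ℕ) : Set (SymMat n) := {A | (A : Matrix (Fin n) (Fin n) ℝ).PosSemidef}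

/-- The Hessian matrix (D²f)(x) of a real function on ℝⁿ. -/
def hessMatrix (f : EucSp n → ℝ) (x : EucSp n) : Matrix (Fin n) (Fin n) ℝ :=
  Matrix.of fun i j =>
    iteratedFDeriv ℝ 2 f x ![EuclideanSpace.single i 1, EuclideanSpace.single j 1]

/-- ψ is a test function for u at x₀ (relative to the set X): ψ is C² near x₀,
u ≤ ψ near x₀ (within X), and u(x₀) = ψ(x₀). -/
def IsTestAt (X : Set (EucSp n)) (u : EucSp n → EReal) (ψ : EucSp n → ℝ) (x₀ : EucSp n) :
    Prop :=
  ContDiffAt ℝ 2 ψ x₀ ∧ (∀ᶠ x in 𝓝[X] x₀, u x ≤ (ψ x : EReal)) ∧ u x₀ = (ψ x₀ : EReal)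

/-- u admits no test functions at x₀ (relative to X). -/
def NoTestAt (X : Set (EucSp n)) (u : EucSp n → EReal) (x₀ : EucSp n) : Prop :=
  ∀ ψ : EucSp n → ℝ, ¬ IsTestAt X u ψ x₀

/-- u is S-subharmonic on X (viscosity sense): u is upper semicontinuous on X with values
in [−∞,∞), and for every test function ψ for u at a point of X, the Hessian of ψ there
lies in S. -/
def FSubharmonicOn (S : Set (SymMat n)) (X : Set (EucSp n)) (u : EucSp n → EReal) : Prop :=
  UpperSemicontinuousOn u X ∧ (∀ x ∈ X, u x ≠ ⊤) ∧
    ∀ x₀ ∈ X, ∀ ψ : EucSp n → ℝ, IsTestAt X u ψ x₀ →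
      hessMatrix ψ x₀ ∈ Subtype.val '' S

/-- u is F-harmonic on X: u is F-subharmonic and −u is F̃-subharmonic on X. -/
def FHarmonicOn (F : ConeSubequation n) (X : Set (EucSp n)) (u : EucSp n → EReal) : Prop :=
  FSubharmonicOn F.carrier X u ∧ FSubharmonicOn (dualSet F.carrier) X (fun x => -u x)

/-- u is subaffine on X, i.e. P̃-subharmonic on X. -/
def SubaffineOn (X : Set (EucSp n)) (u : EucSp n → EReal) : Prop :=
  FSubharmonicOn (dualSet (PosP n)) X u

/-- h is a downward-pointing singular F-harmonic at x₀ on the neighborhood U: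
continuous, F-subharmonic on U, F-harmonic on U∖{x₀}, with a strict minimum at x₀, and
either of polar type (h(x₀) = −∞) or of finite type (h(x₀) > −∞, no test functions at x₀). -/
structure DPSingular (F : ConeSubequation n) (U : Set (EucSp n)) (x₀ : EucSp n)
    (h : EucSp n → EReal) : Prop where
  isOpen' : IsOpen U
  mem : x₀ ∈ U
  cont : ContinuousOn h U
  subh : FSubharmonicOn F.carrier U h
  harm : FHarmonicOn F (U \ {x₀}) h
  strictMin : ∀ x ∈ U, x ≠ x₀ → h x₀ < h x
  polarOrFinite : h x₀ = ⊥ ∨ (h x₀ ≠ ⊥ ∧ NoTestAt U h x₀)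

/-- Polar-case asymptotic equivalence H ≈ h at x₀: h − C ≤ H ≤ h + C near x₀. -/
def PolarAsymp (H : EucSp n → ℝ) (h : EucSp n → EReal) (x₀ : EucSp n) : Prop :=
  ∃ C : ℝ, ∀ᶠ x in 𝓝[≠] x₀, h x - (C : EReal) ≤ (H x : EReal) ∧ (H x : EReal) ≤ h x + (C : EReal)

/-- Finite-case asymptotic equivalence H ∼ h at x₀:
lim_{x→x₀} (H(x) − H(x₀))/(h(x) − h(x₀)) = 1. -/
def FiniteAsymp (H : EucSp n → ℝ) (h : EucSp n → EReal) (x₀ : EucSp n) : Prop :=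
  Tendsto (fun x => (H x - H x₀) / ((h x).toReal - (h x₀).toReal)) (𝓝[≠] x₀) (𝓝 1)

/-- Ω is a bounded domain: open, connected and bounded. -/
def IsBoundedDomain (Ω : Set (EucSp n)) : Prop :=
  IsOpen Ω ∧ IsConnected Ω ∧ Bornology.IsBounded Ω

/-- Condition (F3): −P_e ∉ F for every unit vector e. -/
def CondF3 (F : ConeSubequation n) : Prop :=
  ∀ e : EucSp n, ‖e‖ = 1 → -(symProj e) ∉ F.carrier

/-- The inward unit normal −∇ρ(x)/|∇ρ(x)| of the hypersurface {ρ = 0} bounding {ρ < 0}. -/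
def innerNormal (ρ : EucSp n → ℝ) (x : EucSp n) : EucSp n :=
  -(‖gradient ρ x‖⁻¹ • gradient ρ x)

/-- The second fundamental form of {ρ = 0} at x with respect to the inward normal,
extended by zero on the normal line: the tangential part of Hess ρ(x)/|∇ρ(x)|. -/
def secondFF (ρ : EucSp n → ℝ) (x : EucSp n) : Matrix (Fin n) (Fin n) ℝ :=
  ‖gradient ρ x‖⁻¹ •
    ((1 - projMat (innerNormal ρ x)) * hessMatrix ρ x * (1 - projMat (innerNormal ρ x)))

/-- Ω has smooth boundary which is strictly F-convex: Ω is globally defined by a smooth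
defining function ρ with nonvanishing gradient along ∂Ω, and at every boundary point
II_x + t·P_{ν(x)} ∈ Int F for all sufficiently large t. -/
def StrictlyConvexBoundary (F : ConeSubequation n) (Ω : Set (EucSp n)) : Prop :=
  ∃ ρ : EucSp n → ℝ, ContDiff ℝ (⊤ : ℕ∞) ρ ∧ Ω = {x | ρ x < 0} ∧
    ∀ x ∈ frontier Ω, gradient ρ x ≠ 0 ∧
      ∃ t₀ : ℝ, ∀ t ≥ t₀,
        secondFF ρ x + t • projMat (innerNormal ρ x) ∈ Subtype.val '' interior F.carrier

/-- F is invariant under O(n): gᵀ A g ∈ F for every orthogonal g and A ∈ F. -/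
def OrthInvariant (F : ConeSubequation n) : Prop :=
  ∀ g : Matrix (Fin n) (Fin n) ℝ, g.transpose * g = 1 →
    ∀ A ∈ F.carrier, ∀ B : SymMat n,
      (B : Matrix (Fin n) (Fin n) ℝ) = g.transpose * (A : Matrix (Fin n) (Fin n) ℝ) * g →
      B ∈ F.carrier

/-- F has Riesz characteristic p: P_{e⊥} − (p−1)P_e ∈ ∂F for every unit vector e. -/
def HasRieszChar (F : ConeSubequation n) (p : ℝ) : Prop :=
  ∀ e : EucSp n, ‖e‖ = 1 → charMat p e ∈ frontier F.carrier

/-- The Riesz kernel K_p. -/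
def rieszKernel (p : ℝ) (x : EucSp n) : ℝ :=
  if p = 2 then Real.log ‖x‖ else -(p - 2)⁻¹ * ‖x‖ ^ (2 - p)

section Semiconvex

open scoped RealInnerProductSpace

variable {E : Type*} [NormedAddCommGroup E] [InnerProductSpace ℝ E]

/-- `q` selects, at every point, the slope of a paraboloid of opening `-Λ` supporting `u` from
below on the whole space. -/
def HasLowerSupport (u : E → ℝ) (q : E → E) (Λ : ℝ) : Prop :=
  ∀ x y, u x + ⟪q x, y - x⟫ - Λ * ‖y - x‖ ^ 2 ≤ u y

lemma eq_zero_of_inner_le_mul_sq {a : E} {C : ℝ} (h : ∀ k : E, ⟪a, k⟫ ≤ C * ‖k‖ ^ 2) : a = 0 := by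
  by_contra ha
  have hn : 0 < ‖a‖ ^ 2 := by positivity
  have hs : 0 < (2 * (|C| + 1))⁻¹ := by positivity
  have h1 := h ((2 * (|C| + 1))⁻¹ • a)
  set s := (2 * (|C| + 1))⁻¹ with hsdef
  have hs2 : s * (2 * (|C| + 1)) = 1 := inv_mul_cancel₀ (by positivity)
  rw [inner_smul_right, real_inner_self_eq_norm_sq, norm_smul, Real.norm_eq_abs, abs_of_pos hs,
    mul_pow] at h1
  have h2 : 1 ≤ C * s := by
    by_contra! hlt
    have : s * ‖a‖ ^ 2 * (C * s) < s * ‖a‖ ^ 2 * 1 := by gcongr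
    nlinarith
  nlinarith [le_abs_self C]

lemma HasLowerSupport.norm_slope_sub_le {u : E → ℝ} {q : E → E} {Λ : ℝ}
    (hu : HasLowerSupport u q Λ) (hΛ : 0 ≤ Λ) {x : E}
    (hx : ∀ y, u y ≤ u x + ⟪q x, y - x⟫ + Λ * ‖y - x‖ ^ 2) (y : E) :
    ‖q y - q x‖ ≤ 6 * Λ * ‖y - x‖ := by
  by_cases hv : q y - q x = 0
  · rw [hv, norm_zero]; positivity
  have hvn : 0 < ‖q y - q x‖ := norm_pos_iff.mpr hv
  have hyx : 0 < ‖y - x‖ := by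
    rw [norm_pos_iff]; intro h0
    exact hv (by rw [sub_eq_zero.mp h0, sub_self])
  set k : E := (‖y - x‖ / ‖q y - q x‖) • (q y - q x) with hk
  have hkn : ‖k‖ = ‖y - x‖ := by
    rw [hk, norm_smul, Real.norm_eq_abs, abs_of_pos (by positivity)]; field_simp
  have hik : ⟪q y - q x, k⟫ = ‖y - x‖ * ‖q y - q x‖ := by
    rw [hk, inner_smul_right, real_inner_self_eq_norm_sq]; field_simp
  have h1 := hu y (y + k)
  have h2 := hx (y + k)
  have h3 := hu x y
  rw [add_sub_cancel_left, hkn] at h1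
  have h4 : ‖y + k - x‖ ≤ 2 * ‖y - x‖ := by
    calc ‖y + k - x‖ = ‖(y - x) + k‖ := by congr 1; abel
      _ ≤ ‖y - x‖ + ‖k‖ := norm_add_le _ _
      _ = 2 * ‖y - x‖ := by rw [hkn]; ring
  have h5 : ‖y + k - x‖ ^ 2 ≤ 4 * ‖y - x‖ ^ 2 := by
    nlinarith [norm_nonneg (y + k - x)]
  have h6 : ⟪q x, y + k - x⟫ = ⟪q x, y - x⟫ + ⟪q x, k⟫ := by
    rw [← inner_add_right]; congr 1; abel
  rw [inner_sub_left] at hik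
  have h7 : Λ * ‖y + k - x‖ ^ 2 ≤ Λ * (4 * ‖y - x‖ ^ 2) := by gcongr
  have h8 : ‖y - x‖ * ‖q y - q x‖ ≤ ‖y - x‖ * (6 * Λ * ‖y - x‖) := by nlinarith
  exact le_of_mul_le_mul_left h8 hyx

lemma abs_sub_le_of_forall_step {g : ℝ → ℝ} {a c : ℝ}
    (hg : ∀ s ∈ Set.Icc (0 : ℝ) 1, ∀ t ∈ Set.Icc (0 : ℝ) 1,
      g s - a * |t - s| - c * (t - s) ^ 2 ≤ g t) :
    |g 1 - g 0| ≤ a := by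
  have key : ∀ N : ℕ, |g 1 - g 0| ≤ a + c * (1 / ((N : ℝ) + 1)) := by
    intro N
    have hN : (0 : ℝ) < (N : ℝ) + 1 := by positivity
    have hsum : g 1 - g 0 = ∑ i ∈ Finset.range (N + 1),
        (g ((i + 1 : ℕ) / ((N : ℝ) + 1)) - g ((i : ℕ) / ((N : ℝ) + 1))) := by
      rw [Finset.sum_range_sub (fun i : ℕ => g ((i : ℝ) / ((N : ℝ) + 1)))]
      push_cast
      rw [div_self hN.ne', zero_div]
    have hmem : ∀ i : ℕ, i ≤ N + 1 → (i : ℝ) / ((N : ℝ) + 1) ∈ Set.Icc (0 : ℝ) 1 := by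
      intro i hi
      refine ⟨by positivity, ?_⟩
      rw [div_le_one hN]
      exact_mod_cast hi
    rw [hsum]
    refine (Finset.abs_sum_le_sum_abs _ _).trans ?_
    have hstep : ∀ i ∈ Finset.range (N + 1),
        |g ((i + 1 : ℕ) / ((N : ℝ) + 1)) - g ((i : ℕ) / ((N : ℝ) + 1))|
          ≤ a * (1 / ((N : ℝ) + 1)) + c * (1 / ((N : ℝ) + 1)) ^ 2 := by
      intro i hi
      rw [Finset.mem_range] at hi
      have h1 := hg _ (hmem i (by omega)) _ (hmem (i + 1) (by omega))
      have h2 := hg _ (hmem (i + 1) (by omega)) _ (hmem i (by omega))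
      have hd : ((i + 1 : ℕ) : ℝ) / ((N : ℝ) + 1) - (i : ℝ) / ((N : ℝ) + 1)
          = 1 / ((N : ℝ) + 1) := by
        push_cast; ring
      have hd' : (i : ℝ) / ((N : ℝ) + 1) - ((i + 1 : ℕ) : ℝ) / ((N : ℝ) + 1)
          = -(1 / ((N : ℝ) + 1)) := by
        rw [← hd]; ring
      have hp : 0 < 1 / ((N : ℝ) + 1) := by positivity
      rw [hd, abs_of_pos hp] at h1
      rw [hd', abs_neg, abs_of_pos hp, neg_sq] at h2
      rw [abs_le]
      constructor <;> linarith
    refine (Finset.sum_le_sum hstep).trans (le_of_eq ?_)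
    rw [Finset.sum_const, Finset.card_range, nsmul_eq_mul]
    push_cast
    field_simp
  have hlim : Tendsto (fun N : ℕ => a + c * (1 / ((N : ℝ) + 1))) atTop (𝓝 (a + c * 0)) :=
    tendsto_const_nhds.add (tendsto_one_div_add_atTop_nhds_zero_nat.const_mul c)
  rw [mul_zero, add_zero] at hlim
  exact ge_of_tendsto' hlim key

lemma HasLowerSupport.taylor {u : E → ℝ} {q : E → E} {Λ : ℝ}
    (hu : HasLowerSupport u q Λ) {x : E} {A : E →L[ℝ] E} (hq : HasFDerivAt q A x)
    {η : ℝ} (hη : 0 < η) :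
    ∀ᶠ y in 𝓝 x,
      |u y - u x - ⟪q x, y - x⟫ - ⟪A (y - x), y - x⟫ / 2| ≤ η * ‖y - x‖ ^ 2 := by
  have h1 := (hasFDerivAt_iff_isLittleO.mp hq).def hη
  obtain ⟨r, hr, hball⟩ := Metric.eventually_nhds_iff_ball.mp h1
  filter_upwards [Metric.ball_mem_nhds x hr] with y hy
  set h := y - x with hh
  have hhr : ‖h‖ < r := by rwa [hh, ← dist_eq_norm]
  have key := abs_sub_le_of_forall_step
    (g := fun t => u (x + t • h) - u x - t * ⟪q x, h⟫ - t ^ 2 * ⟪A h, h⟫ / 2)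
    (a := η * ‖h‖ ^ 2) (c := Λ * ‖h‖ ^ 2 + ⟪A h, h⟫ / 2) ?_
  · have hx1 : x + (1 : ℝ) • h = y := by rw [one_smul, hh]; abel
    have hx0 : x + (0 : ℝ) • h = x := by simp
    simp only [hx1, hx0] at key
    convert key using 2
    ring
  · intro s hs t ht
    have hz : x + s • h ∈ Metric.ball x r := by
      rw [mem_ball_iff_norm, add_sub_cancel_left, norm_smul, Real.norm_eq_abs, abs_of_nonneg hs.1]
      exact (mul_le_of_le_one_left (norm_nonneg _) hs.2).trans_lt hhr
    have h2 := hball _ hz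
    rw [add_sub_cancel_left, norm_smul, Real.norm_eq_abs, abs_of_nonneg hs.1, map_smul] at h2
    have h3 : ‖q (x + s • h) - q x - s • A h‖ ≤ η * ‖h‖ := by
      refine h2.trans ?_
      gcongr
      exact mul_le_of_le_one_left (norm_nonneg _) hs.2
    have h4 := hu (x + s • h) (x + t • h)
    have h5 : x + t • h - (x + s • h) = (t - s) • h := by rw [sub_smul]; abel
    rw [h5, norm_smul, mul_pow, Real.norm_eq_abs, sq_abs, inner_smul_right] at h4
    have h6 : |⟪q (x + s • h) - q x - s • A h, h⟫| ≤ η * ‖h‖ ^ 2 := by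
      refine (abs_real_inner_le_norm _ _).trans ?_
      rw [pow_two, ← mul_assoc]
      gcongr
    have h7 : ⟪q (x + s • h), h⟫
        = ⟪q (x + s • h) - q x - s • A h, h⟫ + ⟪q x, h⟫ + s * ⟪A h, h⟫ := by
      rw [inner_sub_left, inner_sub_left, real_inner_smul_left]; ring
    set e := ⟪q (x + s • h) - q x - s • A h, h⟫ with he
    rw [h7] at h4
    have h8 : -(|t - s| * (η * ‖h‖ ^ 2)) ≤ (t - s) * e := by
      refine neg_le_of_abs_le ?_
      rw [abs_mul]
      gcongr
    nlinarith

end Semiconvex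

section Jensen

open scoped RealInnerProductSpace NNReal
open MeasureTheory

variable {E : Type*} [NormedAddCommGroup E] [InnerProductSpace ℝ E] [FiniteDimensional ℝ E]

/-- A map which is uniformly Lipschitz at the points of a set is differentiable at almost every
point of that set. -/
lemma ae_differentiableAt_of_norm_sub_le [MeasurableSpace E] [BorelSpace E]
    {μ : Measure E} [μ.IsAddHaarMeasure] {q : E → E} {D : Set E} {L : ℝ≥0}
    (hq : ∀ x ∈ D, ∀ y, ‖q y - q x‖ ≤ L * ‖y - x‖) :
    ∀ᵐ x ∂μ, x ∈ D → DifferentiableAt ℝ q x := by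
  have hlip : LipschitzOnWith L q D := LipschitzOnWith.of_dist_le_mul fun y _ x hx => by
    rw [dist_eq_norm, dist_eq_norm]; exact hq x hx y
  obtain ⟨G, hG, hGq⟩ := hlip.extend_finite_dimension
  set K := lipschitzExtensionConstant E * L
  have hd : LipschitzWith 1 (fun y : E => Metric.infDist y D) := Metric.lipschitz_infDist_pt D
  filter_upwards [hG.ae_differentiableAt (μ := μ), hd.ae_differentiableAt (μ := μ)] with x h1 h2 hx
  have hmin : IsLocalMin (fun y : E => Metric.infDist y D) x :=
    Eventually.of_forall fun y => by
      simp only [Metric.infDist_zero_of_mem hx]; exact Metric.infDist_nonneg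
  have h3 := h2.hasFDerivAt
  rw [hmin.hasFDerivAt_eq_zero h3] at h3
  have hne : D.Nonempty := ⟨x, hx⟩
  have hbound : ∀ y, ‖q y - G y‖ ≤ (L + K) * Metric.infDist y D := by
    intro y
    have hLK : (0 : ℝ) ≤ (L : ℝ) + K := by positivity
    refine le_of_forall_pos_le_add fun ε hε => ?_
    obtain ⟨z, hz, hyz⟩ := (Metric.infDist_lt_iff hne (x := y)
      (r := Metric.infDist y D + ε / ((L : ℝ) + K + 1))).mp
      (lt_add_of_pos_right _ (by positivity))
    have h4 : ‖q y - G y‖ ≤ (L + K) * dist y z := by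
      calc ‖q y - G y‖ = ‖(q y - q z) - (G y - G z)‖ := by rw [hGq hz]; congr 1; abel
        _ ≤ ‖q y - q z‖ + ‖G y - G z‖ := norm_sub_le _ _
        _ ≤ L * ‖y - z‖ + K * ‖y - z‖ := by
            gcongr
            · exact hq z hz y
            · rw [← dist_eq_norm, ← dist_eq_norm]; exact hG.dist_le_mul y z
        _ = (L + K) * dist y z := by rw [dist_eq_norm]; ring
    refine h4.trans ((mul_le_mul_of_nonneg_left hyz.le hLK).trans ?_)
    rw [mul_add]
    gcongr
    rw [mul_div_assoc', div_le_iff₀ (by positivity)]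
    nlinarith
  have h5 : HasFDerivAt (fun y => q y - G y) (0 : E →L[ℝ] E) x := by
    rw [hasFDerivAt_iff_isLittleO] at h3 ⊢
    refine Asymptotics.IsBigO.trans_isLittleO ?_ h3
    refine Asymptotics.IsBigO.of_bound ((L : ℝ) + K) (Eventually.of_forall fun y => ?_)
    simp only [Metric.infDist_zero_of_mem hx, hGq hx, sub_self, sub_zero,
      zero_apply]
    rw [Real.norm_of_nonneg Metric.infDist_nonneg]
    exact hbound y
  have h6 := h5.differentiableAt.add h1
  refine h6.congr_of_eventuallyEq (Eventually.of_forall fun y => ?_)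
  simp

/-- If `u + w` touches from below affine functions of every small slope, where `u` and `w` are
supported from below by paraboloids, then it does so at some point at which both slope selections
are differentiable. -/
lemma exists_contact_differentiableAt {u w : E → ℝ} {q r : E → E} {Λ ρ : ℝ} (hΛ : 0 ≤ Λ)
    (hρ : 0 < ρ) (hu : HasLowerSupport u q Λ) (hw : HasLowerSupport w r Λ)
    (hc : ∀ p : E, ‖p‖ < ρ → ∃ x, ∀ y, u y + w y ≤ u x + w x + ⟪p, y - x⟫) :
    ∃ x, (∀ y, u y + w y ≤ u x + w x + ⟪q x + r x, y - x⟫) ∧ ‖q x + r x‖ < ρ ∧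
      DifferentiableAt ℝ q x ∧ DifferentiableAt ℝ r x := by
  borelize E
  set D : Set E := {x | (∀ y, u y + w y ≤ u x + w x + ⟪q x + r x, y - x⟫) ∧ ‖q x + r x‖ < ρ}
    with hD
  have hslope : ∀ p x, (∀ y, u y + w y ≤ u x + w x + ⟪p, y - x⟫) → q x + r x = p := by
    intro p x hpx
    rw [← sub_eq_zero]
    refine eq_zero_of_inner_le_mul_sq (C := 2 * Λ) fun k => ?_
    have h1 := hu x (x + k)
    have h2 := hw x (x + k)
    have h3 := hpx (x + k)
    rw [add_sub_cancel_left] at h1 h2 h3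
    rw [inner_sub_left, inner_add_left]
    linarith
  have hqD : ∀ x ∈ D, ∀ y, ‖q y - q x‖ ≤ (6 * Λ).toNNReal * ‖y - x‖ := by
    intro x hx y
    rw [Real.coe_toNNReal _ (by positivity)]
    refine hu.norm_slope_sub_le hΛ (fun z => ?_) y
    have h1 := hx.1 z
    have h2 := hw x z
    rw [inner_add_left] at h1
    linarith
  have hrD : ∀ x ∈ D, ∀ y, ‖r y - r x‖ ≤ (6 * Λ).toNNReal * ‖y - x‖ := by
    intro x hx y
    rw [Real.coe_toNNReal _ (by positivity)]
    refine hw.norm_slope_sub_le hΛ (fun z => ?_) y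
    have h1 := hx.1 z
    have h2 := hu x z
    rw [inner_add_left] at h1
    linarith
  set μ : Measure E := μH[Module.finrank ℝ E] with hμ
  have hlip : LipschitzOnWith ((6 * Λ).toNNReal + (6 * Λ).toNNReal) (fun x => q x + r x) D :=
    (LipschitzOnWith.of_dist_le_mul fun y _ x hx => by
      rw [dist_eq_norm, dist_eq_norm]; exact hqD x hx y).add
    (LipschitzOnWith.of_dist_le_mul fun y _ x hx => by
      rw [dist_eq_norm, dist_eq_norm]; exact hrD x hx y)
  have himage : Metric.ball (0 : E) ρ ⊆ (fun x => q x + r x) '' D := by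
    intro p hp
    rw [mem_ball_zero_iff] at hp
    obtain ⟨x, hx⟩ := hc p hp
    have hs := hslope p x hx
    exact ⟨x, ⟨by rw [hs]; exact hx, by rw [hs]; exact hp⟩, hs⟩
  have hDpos : μ D ≠ 0 := by
    intro h0
    have h1 := hlip.hausdorffMeasure_image_le (d := (Module.finrank ℝ E : ℝ)) (by positivity)
    rw [← hμ, h0, mul_zero] at h1
    have h2 : μ (Metric.ball (0 : E) ρ) ≤ 0 := (measure_mono himage).trans h1
    exact (Metric.measure_ball_pos μ (0 : E) hρ).not_ge h2
  have hae := (ae_differentiableAt_of_norm_sub_le (μ := μ) hqD).and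
    (ae_differentiableAt_of_norm_sub_le (μ := μ) hrD)
  by_contra! hcon
  apply hDpos
  refine measure_mono_null (fun x hx => ?_) hae
  intro hdiff
  exact hcon x hx.1 hx.2 (hdiff.1 hx) (hdiff.2 hx)

end Jensen

section SupConvolution

open scoped RealInnerProductSpace

variable {E : Type*} [NormedAddCommGroup E]

/-- `U` is the sup-convolution of `u` over `K` with kernel `Λ‖x - y‖²`, attained at `Y`. -/
structure IsSupConvolution (K : Set E) (u : E → ℝ) (Λ : ℝ) (U : E → ℝ) (Y : E → E) : Prop where
  mem : ∀ x, Y x ∈ K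
  eq : ∀ x, U x = u (Y x) - Λ * ‖x - Y x‖ ^ 2
  le : ∀ x, ∀ y ∈ K, u y - Λ * ‖x - y‖ ^ 2 ≤ U x

lemma exists_isSupConvolution {K : Set E} (hK : IsCompact K) (hne : K.Nonempty) {u : E → ℝ}
    (hu : UpperSemicontinuousOn u K) (Λ : ℝ) : ∃ U Y, IsSupConvolution K u Λ U Y := by
  have hex : ∀ x : E, ∃ y ∈ K, IsMaxOn (fun y => u y + -(Λ * ‖x - y‖ ^ 2)) K y := by
    intro x
    have hc : Continuous fun y => -(Λ * ‖x - y‖ ^ 2) := by fun_prop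
    exact UpperSemicontinuousOn.exists_isMaxOn hne hK
      (hu.add hc.continuousOn.upperSemicontinuousOn)
  choose Y hY hmax using hex
  exact ⟨fun x => u (Y x) - Λ * ‖x - Y x‖ ^ 2, Y, hY, fun _ => rfl, fun x y hy => by
    have := hmax x hy
    simp only [Set.mem_ofPred_eq] at this
    linarith⟩

variable [InnerProductSpace ℝ E]

namespace IsSupConvolution

variable {K : Set E} {u U : E → ℝ} {Λ : ℝ} {Y : E → E}

lemma hasLowerSupport (h : IsSupConvolution K u Λ U Y) :
    HasLowerSupport U (fun x => (2 * Λ) • (Y x - x)) Λ := by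
  intro x x'
  have h1 := h.le x' (Y x) (h.mem x)
  rw [h.eq x, real_inner_smul_left]
  refine le_trans (le_of_eq ?_) h1
  have h2 : ‖x' - Y x‖ ^ 2 = ‖x' - x‖ ^ 2 - 2 * ⟪Y x - x, x' - x⟫ + ‖x - Y x‖ ^ 2 := by
    rw [norm_sub_rev x (Y x), real_inner_comm, ← norm_sub_sq_real]
    congr 2; abel
  rw [h2]; ring

lemma continuous (h : IsSupConvolution K u Λ U Y) (hΛ : 0 ≤ Λ) (hK : Bornology.IsBounded K) :
    Continuous U := by
  obtain ⟨C, hC⟩ := hK.exists_norm_le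
  have hls := h.hasLowerSupport
  rw [continuous_iff_continuousAt]
  intro x
  have hlow : Tendsto (fun y => U x + ⟪(2 * Λ) • (Y x - x), y - x⟫ - Λ * ‖y - x‖ ^ 2) (𝓝 x)
      (𝓝 (U x)) := by
    have hcont : Continuous
        (fun y => U x + ⟪(2 * Λ) • (Y x - x), y - x⟫ - Λ * ‖y - x‖ ^ 2) := by fun_prop
    simpa using hcont.tendsto x
  have hup : Tendsto (fun y => U x + 2 * Λ * (C + ‖y‖) * ‖x - y‖ + Λ * ‖x - y‖ ^ 2) (𝓝 x)
      (𝓝 (U x)) := by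
    have hcont : Continuous
        (fun y => U x + 2 * Λ * (C + ‖y‖) * ‖x - y‖ + Λ * ‖x - y‖ ^ 2) := by fun_prop
    simpa using hcont.tendsto x
  refine tendsto_of_tendsto_of_tendsto_of_le_of_le hlow hup (fun y => hls x y) (fun y => ?_)
  have h1 := hls y x
  have h2 : |⟪(2 * Λ) • (Y y - y), x - y⟫| ≤ 2 * Λ * (C + ‖y‖) * ‖x - y‖ := by
    refine (abs_real_inner_le_norm _ _).trans ?_
    rw [norm_smul, Real.norm_of_nonneg (by positivity)]
    gcongr
    exact (norm_sub_le _ _).trans (by gcongr; exact hC _ (h.mem y))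
  have h3 := neg_le_of_abs_le h2
  simp only
  linarith

/-- An upper second-order expansion of a sup-convolution at `x` is inherited, at the point where
the supremum is attained, by the original function. -/
lemma eventually_le_of_taylor (h : IsSupConvolution K u Λ U Y) {x a : E} {A : E →L[ℝ] E}
    (hKY : K ∈ 𝓝 (Y x))
    (hU : ∀ᶠ x' in 𝓝 x, U x' ≤ U x + ⟪a, x' - x⟫ + ⟪A (x' - x), x' - x⟫ / 2) :
    ∀ᶠ y in 𝓝 (Y x), u y ≤ u (Y x) + ⟪a, y - Y x⟫ + ⟪A (y - Y x), y - Y x⟫ / 2 := by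
  have ht : Tendsto (fun y => x + (y - Y x)) (𝓝 (Y x)) (𝓝 x) := by
    have hcont : Continuous (fun y => x + (y - Y x)) := by fun_prop
    simpa using hcont.tendsto (Y x)
  filter_upwards [ht.eventually hU, hKY] with y hy hyK
  have h1 := h.le (x + (y - Y x)) y hyK
  have h2 : x + (y - Y x) - y = x - Y x := by abel
  rw [add_sub_cancel_left] at hy
  rw [h2] at h1
  have h3 := h.eq x
  linarith

end IsSupConvolution

lemma exists_localization {u w : E → ℝ} {y₀ : E} {R κ τ : ℝ} (hR : 0 < R) (hκ : 0 < κ)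
    (hτ : 0 < τ)
    (hK : IsCompact (Metric.closedBall y₀ R))
    (hu : UpperSemicontinuousOn u (Metric.closedBall y₀ R))
    (hw : ContinuousOn w (Metric.closedBall y₀ R))
    (hmax : ∀ y ∈ Metric.closedBall y₀ R, u y + w y ≤ u y₀ + w y₀ - κ * ‖y - y₀‖ ^ 2) :
    ∃ Λ > 0, ∃ P > 0, ∀ p x y z : E, ‖p‖ < P → y ∈ Metric.closedBall y₀ R →
      z ∈ Metric.closedBall y₀ R →
      u y₀ + w y₀ + ⟪p, x - y₀⟫ ≤ u y + w z - Λ * ‖x - y‖ ^ 2 - Λ * ‖x - z‖ ^ 2 →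
      ‖y - y₀‖ < R ∧ ‖z - y₀‖ < R ∧ ‖x - y₀‖ ≤ 2 * R ∧ u y₀ - τ < u y := by
  set K := Metric.closedBall y₀ R with hKdef
  have hy₀ : y₀ ∈ K := Metric.mem_closedBall_self hR.le
  obtain ⟨yu, -, hyu⟩ := UpperSemicontinuousOn.exists_isMaxOn ⟨y₀, hy₀⟩ hK hu
  obtain ⟨yw, -, hyw⟩ := hK.exists_isMaxOn ⟨y₀, hy₀⟩ hw
  set C := u yu + w yw - u y₀ - w y₀ with hC
  have hC0 : 0 ≤ C := by
    have h1 : u y₀ ≤ u yu := hyu hy₀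
    have h2 : w y₀ ≤ w yw := hyw hy₀
    linarith
  obtain ⟨d₁, hd₁, hwd₁⟩ := Metric.continuousOn_iff.mp hw y₀ hy₀ (τ / 4) (by positivity)
  obtain ⟨ρ, hρ, hρR, hρd⟩ : ∃ ρ > 0, 4 * ρ ≤ R ∧ 4 * ρ ≤ d₁ :=
    ⟨min (R / 4) (d₁ / 4), by positivity, by linarith [min_le_left (R / 4) (d₁ / 4)],
      by linarith [min_le_right (R / 4) (d₁ / 4)]⟩
  have hκρ : 0 < κ * ρ ^ 2 := by positivity
  obtain ⟨s, hs, hs1, hs2⟩ : ∃ s > 0, s ≤ τ / 4 ∧ s ≤ κ * ρ ^ 2 / 4 :=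
    ⟨min (τ / 4) (κ * ρ ^ 2 / 4), by positivity, min_le_left _ _, min_le_right _ _⟩
  obtain ⟨d, hd, hwd⟩ := Metric.uniformContinuousOn_iff.mp
    (hK.uniformContinuousOn_of_continuous hw) s hs
  obtain ⟨θ, hθ, hθd, hθρ⟩ : ∃ θ > 0, 3 * θ ≤ d ∧ 2 * θ ≤ ρ :=
    ⟨min (d / 3) (ρ / 2), by positivity, by linarith [min_le_left (d / 3) (ρ / 2)],
      by linarith [min_le_right (d / 3) (ρ / 2)]⟩
  obtain ⟨Λ, hΛ1, hΛ2⟩ : ∃ Λ : ℝ, 1 ≤ Λ ∧ 2 * (C + R + 1) ≤ Λ * θ ^ 2 := by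
    refine ⟨2 * (C + R + 1) / θ ^ 2 + 1,
      by linarith [show 0 ≤ 2 * (C + R + 1) / θ ^ 2 by positivity], ?_⟩
    rw [add_mul, div_mul_cancel₀ _ (by positivity)]
    linarith [show 0 < θ ^ 2 by positivity]
  have hθR : 0 < θ + R := by positivity
  obtain ⟨P, hP, hP1, hP2, hP3⟩ : ∃ P > 0, P ≤ 1 ∧ P * (θ + R) ≤ τ / 4 ∧
      P * (θ + R) ≤ κ * ρ ^ 2 / 2 := by
    refine ⟨min 1 (min (τ / 4) (κ * ρ ^ 2 / 2) / (θ + R)), by positivity, min_le_left _ _, ?_, ?_⟩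
    · exact ((le_div_iff₀ hθR).mp (min_le_right _ _)).trans (min_le_left _ _)
    · exact ((le_div_iff₀ hθR).mp (min_le_right _ _)).trans (min_le_right _ _)
  refine ⟨Λ, by linarith, P, hP, ?_⟩
  intro p x y z hp hy hz hineq
  have hyR : ‖y - y₀‖ ≤ R := by rwa [← mem_closedBall_iff_norm]
  have h1 : ‖x - y₀‖ ≤ ‖x - y‖ + ‖y - y₀‖ := norm_sub_le_norm_sub_add_norm_sub _ _ _
  have h2 : ‖z - y₀‖ ≤ ‖x - z‖ + ‖x - y‖ + ‖y - y₀‖ := by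
    rw [norm_sub_rev x z]
    exact (norm_sub_le_norm_sub_add_norm_sub _ x _).trans (by linarith)
  have h3 : dist y z ≤ ‖x - y‖ + ‖x - z‖ := by
    rw [dist_eq_norm, norm_sub_rev x y]; exact norm_sub_le_norm_sub_add_norm_sub _ _ _
  have h4 : -(‖p‖ * ‖x - y₀‖) ≤ ⟪p, x - y₀⟫ := neg_le_of_abs_le (abs_real_inner_le_norm _ _)
  have huy : u y ≤ u yu := hyu hy
  have hwz : w z ≤ w yw := hyw hz
  have hpx : ‖p‖ * ‖x - y₀‖ ≤ ‖x - y‖ + R := by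
    calc ‖p‖ * ‖x - y₀‖ ≤ 1 * (‖x - y‖ + R) := by gcongr <;> linarith
      _ = _ := one_mul _
  have h5 : Λ * ‖x - y‖ ^ 2 + Λ * ‖x - z‖ ^ 2 ≤ Λ * θ ^ 2 := by
    have h6 : ‖x - y‖ ≤ 1 + ‖x - y‖ ^ 2 / 2 := by nlinarith [sq_nonneg (‖x - y‖ - 1)]
    have h7 : ‖x - y‖ ^ 2 ≤ Λ * ‖x - y‖ ^ 2 := le_mul_of_one_le_left (sq_nonneg _) hΛ1
    have h8 : 0 ≤ Λ * ‖x - z‖ ^ 2 := by positivity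
    linarith
  have hΛpos : 0 < Λ := by linarith
  have hxy : ‖x - y‖ ≤ θ := by
    refine abs_le_of_sq_le_sq' ?_ hθ.le |>.2
    refine le_of_mul_le_mul_left ?_ hΛpos
    linarith [show 0 ≤ Λ * ‖x - z‖ ^ 2 by positivity]
  have hxz : ‖x - z‖ ≤ θ := by
    refine abs_le_of_sq_le_sq' ?_ hθ.le |>.2
    refine le_of_mul_le_mul_left ?_ hΛpos
    linarith [show 0 ≤ Λ * ‖x - y‖ ^ 2 by positivity]
  have hpx' : ‖p‖ * ‖x - y₀‖ ≤ P * (θ + R) := by gcongr; linarith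
  have hsq : 0 ≤ Λ * ‖x - y‖ ^ 2 + Λ * ‖x - z‖ ^ 2 := by positivity
  have hwyz : |w y - w z| < s := hwd y hy z hz (by linarith)
  have hmy := hmax y hy
  have hyρ : ‖y - y₀‖ < ρ := by
    refine abs_lt_of_sq_lt_sq' ?_ hρ.le |>.2
    refine lt_of_mul_lt_mul_left ?_ hκ.le
    linarith [neg_le_of_abs_le hwyz.le]
  have hzy : |w z - w y₀| < τ / 4 := hwd₁ z hz (by rw [dist_eq_norm]; linarith)
  refine ⟨by linarith, by linarith, by linarith, ?_⟩
  linarith [(abs_lt.mp hzy).2]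

/-- A form of the theorem on sums: near a strict maximum of `u + w` there are points at which `u`
and `w` have quadratic upper test functions whose Hessians have almost nonpositive sum. -/
theorem exists_quadratic_tests [FiniteDimensional ℝ E] {u w : E → ℝ} {y₀ : E} {R κ τ η : ℝ}
    (hR : 0 < R) (hκ : 0 < κ) (hτ : 0 < τ) (hη : 0 < η)
    (hu : UpperSemicontinuousOn u (Metric.closedBall y₀ R))
    (hw : ContinuousOn w (Metric.closedBall y₀ R))
    (hmax : ∀ y ∈ Metric.closedBall y₀ R, u y + w y ≤ u y₀ + w y₀ - κ * ‖y - y₀‖ ^ 2) :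
    ∃ y ∈ Metric.ball y₀ R, ∃ z ∈ Metric.ball y₀ R, u y₀ - τ < u y ∧
      ∃ (a b : E) (A B : E →L[ℝ] E),
        (∀ᶠ y' in 𝓝 y, u y' ≤ u y + ⟪a, y' - y⟫ + ⟪A (y' - y), y' - y⟫ / 2) ∧
        (∀ᶠ z' in 𝓝 z, w z' ≤ w z + ⟪b, z' - z⟫ + ⟪B (z' - z), z' - z⟫ / 2) ∧
        ∀ h : E, ⟪A h, h⟫ + ⟪B h, h⟫ ≤ η * ‖h‖ ^ 2 := by
  have hK : IsCompact (Metric.closedBall y₀ R) := isCompact_closedBall _ _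
  have hy₀ : y₀ ∈ Metric.closedBall y₀ R := Metric.mem_closedBall_self hR.le
  obtain ⟨Λ, hΛ, P, hP, hloc⟩ := exists_localization hR hκ hτ hK hu hw hmax
  obtain ⟨U, Y, hU⟩ := exists_isSupConvolution hK ⟨y₀, hy₀⟩ hu Λ
  obtain ⟨W, Z, hW⟩ := exists_isSupConvolution hK ⟨y₀, hy₀⟩ hw.upperSemicontinuousOn Λ
  have hU₀ : u y₀ ≤ U y₀ := by simpa using hU.le y₀ y₀ hy₀
  have hW₀ : w y₀ ≤ W y₀ := by simpa using hW.le y₀ y₀ hy₀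
  have hloc' : ∀ p x, ‖p‖ < P → u y₀ + w y₀ + ⟪p, x - y₀⟫ ≤ U x + W x →
      ‖Y x - y₀‖ < R ∧ ‖Z x - y₀‖ < R ∧ ‖x - y₀‖ ≤ 2 * R ∧ u y₀ - τ < u (Y x) := by
    intro p x hp hx
    refine hloc p x (Y x) (Z x) hp (hU.mem x) (hW.mem x) ?_
    rw [hU.eq, hW.eq] at hx
    linarith
  have hcontact : ∀ p : E, ‖p‖ < P → ∃ x, ∀ y, U y + W y ≤ U x + W x + ⟪p, y - x⟫ := by
    intro p hp
    have hcont : Continuous fun x => U x + W x - ⟪p, x - y₀⟫ :=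
      ((hU.continuous hΛ.le hK.isBounded).add (hW.continuous hΛ.le hK.isBounded)).sub
        (by fun_prop)
    have hy₀' : y₀ ∈ Metric.closedBall y₀ (2 * R) := Metric.mem_closedBall_self (by positivity)
    obtain ⟨x, -, hx⟩ := (isCompact_closedBall y₀ (2 * R)).exists_isMaxOn ⟨y₀, hy₀'⟩
      hcont.continuousOn
    have hx₀ : U y₀ + W y₀ - ⟪p, y₀ - y₀⟫ ≤ U x + W x - ⟪p, x - y₀⟫ := hx hy₀'
    rw [sub_self, inner_zero_right] at hx₀
    refine ⟨x, fun y => ?_⟩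
    have hyx : ⟪p, y - x⟫ = ⟪p, y - y₀⟫ - ⟪p, x - y₀⟫ := by
      rw [← inner_sub_right]; congr 1; abel
    rw [hyx]
    by_cases hy : y ∈ Metric.closedBall y₀ (2 * R)
    · have : U y + W y - ⟪p, y - y₀⟫ ≤ U x + W x - ⟪p, x - y₀⟫ := hx hy
      linarith
    · by_contra! hlt
      refine hy ?_
      rw [mem_closedBall_iff_norm]
      exact (hloc' p y hp (by linarith)).2.2.1
  have hlsU := hU.hasLowerSupport
  have hlsW := hW.hasLowerSupport
  obtain ⟨x, hx, hpx, ⟨A, hA⟩, ⟨B, hB⟩⟩ :=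
    exists_contact_differentiableAt hΛ.le hP hlsU hlsW hcontact
  obtain ⟨hYx, hZx, -, huY⟩ := hloc' _ x hpx (by
    have h1 := hx y₀
    rw [← neg_sub x y₀, inner_neg_right] at h1
    linarith)
  rw [← mem_ball_iff_norm] at hYx hZx
  have hsum : ∀ h : E, ⟪A h, h⟫ + ⟪B h, h⟫ ≤ 0 := by
    intro h
    refine le_of_forall_pos_le_add fun ε hε => ?_
    have hε' : 0 < ε / (4 * (‖h‖ ^ 2 + 1)) := by positivity
    have ht : Tendsto (fun t : ℝ => x + t • h) (𝓝[>] 0) (𝓝 x) := by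
      have hcont : Continuous (fun t : ℝ => x + t • h) := by fun_prop
      simpa using (hcont.tendsto 0).mono_left nhdsWithin_le_nhds
    obtain ⟨t, ⟨h1, h2⟩, ht0⟩ := ((ht.eventually
      ((hlsU.taylor hA hε').and (hlsW.taylor hB hε'))).and self_mem_nhdsWithin).exists
    have h3 := hx (x + t • h)
    rw [add_sub_cancel_left] at h1 h2 h3
    have h1' := neg_le_of_abs_le h1
    have h2' := neg_le_of_abs_le h2
    rw [inner_add_left] at h3
    rw [inner_smul_right _ _ t, inner_smul_right _ _ t, norm_smul, Real.norm_of_nonneg ht0.le,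
      map_smul] at h1' h2'
    rw [real_inner_smul_left (A h)] at h1'
    rw [real_inner_smul_left (B h)] at h2'
    rw [inner_smul_right, inner_smul_right] at h3
    have h4 : ε / (4 * (‖h‖ ^ 2 + 1)) * (t * ‖h‖) ^ 2 ≤ t ^ 2 * (ε / 4) := by
      have h5 : ε / (4 * (‖h‖ ^ 2 + 1)) * ‖h‖ ^ 2 ≤ ε / 4 := by
        rw [div_mul_eq_mul_div, div_le_div_iff₀ (by positivity) (by norm_num)]
        nlinarith [sq_nonneg ‖h‖]
      calc ε / (4 * (‖h‖ ^ 2 + 1)) * (t * ‖h‖) ^ 2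
          = t ^ 2 * (ε / (4 * (‖h‖ ^ 2 + 1)) * ‖h‖ ^ 2) := by ring
        _ ≤ _ := by gcongr
    have ht2 : 0 < t ^ 2 := by positivity
    refine le_of_mul_le_mul_left ?_ ht2
    nlinarith
  have hη4 : 0 < η / 4 := by positivity
  have hquad : ∀ (T : E →L[ℝ] E) (h : E),
      ⟪(T + (η / 2) • ContinuousLinearMap.id ℝ E) h, h⟫ = ⟪T h, h⟫ + η / 2 * ‖h‖ ^ 2 := by
    intro T h
    simp [inner_add_left, real_inner_smul_left]
  refine ⟨Y x, hYx, Z x, hZx, huY, (2 * Λ) • (Y x - x), (2 * Λ) • (Z x - x),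
    A + (η / 2) • ContinuousLinearMap.id ℝ E,
    B + (η / 2) • ContinuousLinearMap.id ℝ E,
    hU.eventually_le_of_taylor (mem_of_superset (Metric.isOpen_ball.mem_nhds hYx)
      Metric.ball_subset_closedBall) ?_,
    hW.eventually_le_of_taylor (mem_of_superset (Metric.isOpen_ball.mem_nhds hZx)
      Metric.ball_subset_closedBall) ?_, fun h => ?_⟩
  · filter_upwards [hlsU.taylor hA hη4] with y hy
    rw [hquad]
    linarith [le_of_abs_le hy]
  · filter_upwards [hlsW.taylor hB hη4] with y hy
    rw [hquad]
    linarith [le_of_abs_le hy]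
  · rw [hquad, hquad]
    linarith [hsum h]

end SupConvolution

section Hessian

open scoped RealInnerProductSpace

/-- The symmetric matrix of the quadratic form `h ↦ ⟪A h, h⟫`. -/
def symMatOf (A : EucSp n →L[ℝ] EucSp n) : SymMat n :=
  ⟨Matrix.of fun i j => (⟪A (EuclideanSpace.single i 1), EuclideanSpace.single j 1⟫ +
      ⟪A (EuclideanSpace.single j 1), EuclideanSpace.single i 1⟫) / 2, by
    rw [selfAdjoint.mem_iff]
    ext i j
    simp [Matrix.star_apply, add_comm]⟩

lemma symMatOf_apply (A : EucSp n →L[ℝ] EucSp n) (i j : Fin n) :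
    (symMatOf A).1 i j = (⟪A (EuclideanSpace.single i 1), EuclideanSpace.single j 1⟫ +
      ⟪A (EuclideanSpace.single j 1), EuclideanSpace.single i 1⟫) / 2 := rfl

lemma symMatOf_add (A B : EucSp n →L[ℝ] EucSp n) :
    symMatOf (A + B) = symMatOf A + symMatOf B := by
  apply Subtype.ext
  ext i j
  rw [AddSubgroup.coe_add, Matrix.add_apply]
  simp only [symMatOf_apply, add_apply, inner_add_left]
  ring

lemma symMatOf_neg (A : EucSp n →L[ℝ] EucSp n) : symMatOf (-A) = -symMatOf A := by
  apply Subtype.ext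
  ext i j
  rw [AddSubgroup.coe_neg, Matrix.neg_apply]
  simp only [symMatOf_apply, neg_apply, inner_neg_left]
  ring

lemma symMatOf_smul (t : ℝ) (A : EucSp n →L[ℝ] EucSp n) :
    symMatOf (t • A) = t • symMatOf A := by
  apply Subtype.ext
  ext i j
  rw [selfAdjoint.val_smul, Matrix.smul_apply, smul_eq_mul]
  simp only [symMatOf_apply, smul_apply, real_inner_smul_left]
  ring

lemma sum_mul_symMatOf (A : EucSp n →L[ℝ] EucSp n) (h : EucSp n) :
    ∑ i, ∑ j, h i * (symMatOf A).1 i j * h j = ⟪A h, h⟫ := by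
  have hh : h = ∑ i, h i • EuclideanSpace.single i (1 : ℝ) := by
    ext j
    simp [Finset.sum_apply, Pi.single_apply]
  have hA : ⟪A h, h⟫ = ∑ i, ∑ j, h i * ⟪A (EuclideanSpace.single i 1),
      EuclideanSpace.single j 1⟫ * h j := by
    conv_lhs => rw [hh]
    simp only [map_sum, map_smul, sum_inner, inner_sum, real_inner_smul_left, inner_smul_right,
      Finset.mul_sum]
    rw [Finset.sum_comm]
    refine Finset.sum_congr rfl fun i _ => Finset.sum_congr rfl fun j _ => ?_
    ring
  have hA' : ⟪A h, h⟫ = ∑ i, ∑ j, h i * ⟪A (EuclideanSpace.single j 1),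
      EuclideanSpace.single i 1⟫ * h j := by
    rw [hA, Finset.sum_comm]
    refine Finset.sum_congr rfl fun i _ => Finset.sum_congr rfl fun j _ => ?_
    ring
  have hsum : ∑ i, ∑ j, h i * (symMatOf A).1 i j * h j = (⟪A h, h⟫ + ⟪A h, h⟫) / 2 := by
    conv_rhs => lhs; lhs; rw [hA]
    rw [hA', ← Finset.sum_add_distrib, Finset.sum_div]
    refine Finset.sum_congr rfl fun i _ => ?_
    rw [← Finset.sum_add_distrib, Finset.sum_div]
    refine Finset.sum_congr rfl fun j _ => ?_
    rw [symMatOf_apply]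
    ring
  rw [hsum]
  ring

lemma hessMatrix_quadratic (c : ℝ) (a : EucSp n) (A : EucSp n →L[ℝ] EucSp n) (x : EucSp n) :
    hessMatrix (fun y => c + ⟪a, y - x⟫ + ⟪A (y - x), y - x⟫ / 2) x = (symMatOf A).1 := by
  set L : EucSp n →L[ℝ] EucSp n →L[ℝ] ℝ := (innerSL ℝ : EucSp n →L[ℝ] EucSp n →L[ℝ] ℝ).comp A
    with hL
  have hd : ∀ y, HasFDerivAt (fun y => c + ⟪a, y - x⟫ + ⟪A (y - x), y - x⟫ / 2)
      (innerSL ℝ a + (2⁻¹ : ℝ) • (L + L.flip) (y - x)) y := by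
    intro y
    have hid : HasFDerivAt (fun y : EucSp n => y - x) (ContinuousLinearMap.id ℝ _) y :=
      (hasFDerivAt_id y).sub_const x
    have h1 := ((innerSL ℝ a).hasFDerivAt (x := y - x)).comp y hid
    have h2 := ((A.hasFDerivAt (x := y - x)).comp y hid).inner ℝ hid
    have h3 := (h1.const_add c).add (h2.const_smul (2⁻¹ : ℝ))
    refine (h3.congr_fderiv ?_).congr_of_eventuallyEq (Eventually.of_forall fun z => ?_)
    · ext k
      simp [hL, real_inner_comm]
      rw [inner_sub_right, inner_sub_left]
      ring
    · simp
      ring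
  have hfd : fderiv ℝ (fun y => c + ⟪a, y - x⟫ + ⟪A (y - x), y - x⟫ / 2)
      = fun y => innerSL ℝ a + (2⁻¹ : ℝ) • (L + L.flip) (y - x) := funext fun y => (hd y).fderiv
  have hd2 : ∀ M : EucSp n →L[ℝ] EucSp n →L[ℝ] ℝ,
      HasFDerivAt (fun y => innerSL ℝ a + (2⁻¹ : ℝ) • M (y - x)) ((2⁻¹ : ℝ) • M) x := by
    intro M
    have hM : HasFDerivAt (fun y => M (y - x)) M x := by
      simpa only [map_sub] using (M.hasFDerivAt (x := x)).sub_const (M x)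
    exact (hM.const_smul (2⁻¹ : ℝ)).const_add (innerSL ℝ a)
  ext i j
  rw [hessMatrix, Matrix.of_apply, iteratedFDeriv_two_apply, hfd, (hd2 _).fderiv, symMatOf_apply]
  change (2⁻¹ : ℝ) * (⟪A (EuclideanSpace.single i 1), EuclideanSpace.single j 1⟫ +
    ⟪A (EuclideanSpace.single j 1), EuclideanSpace.single i 1⟫) = _
  ring

lemma FSubharmonicOn.symMatOf_mem {S : Set (SymMat n)} {X : Set (EucSp n)} {u : EucSp n → EReal}
    (hu : FSubharmonicOn S X u) {y a : EucSp n} {c : ℝ} {A : EucSp n →L[ℝ] EucSp n} (hy : y ∈ X)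
    (huy : u y = (c : EReal))
    (hA : ∀ᶠ y' in 𝓝 y, u y' ≤ ((c + ⟪a, y' - y⟫ + ⟪A (y' - y), y' - y⟫ / 2 : ℝ) : EReal)) :
    symMatOf A ∈ S := by
  have hsm : ContDiff ℝ 2 (fun y' => c + ⟪a, y' - y⟫ + ⟪A (y' - y), y' - y⟫ / 2) := by
    have h1 : ContDiff ℝ 2 (fun y' : EucSp n => y' - y) := contDiff_id.sub contDiff_const
    exact (contDiff_const.add (contDiff_const.inner ℝ h1)).add
      (((A.contDiff.comp h1).inner ℝ h1).div_const 2)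
  obtain ⟨B, hB, hBA⟩ := hu.2.2 y hy _ ⟨hsm.contDiffAt, hA.filter_mono nhdsWithin_le_nhds,
    by rw [huy]; simp⟩
  rw [hessMatrix_quadratic] at hBA
  rwa [← Subtype.ext hBA]

lemma ConeSubequation.add_mem_interior (F : ConeSubequation n) {A D : SymMat n}
    (hA : A ∈ F.carrier) {c : ℝ} (hc : 0 < c)
    (hD : ∀ h : EucSp n, c * ‖h‖ ^ 2 ≤ ∑ i, ∑ j, h i * D.1 i j * h j) :
    A + D ∈ interior F.carrier := by
  rw [mem_interior_iff_mem_nhds]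
  set ε : ℝ := c / (n + 1) with hε
  have hεpos : 0 < ε := by positivity
  have hεn : ε * n ≤ c := by
    rw [hε, div_mul_eq_mul_div, div_le_iff₀ (by positivity)]
    nlinarith
  have hev : ∀ᶠ B : SymMat n in 𝓝 (A + D), ∀ i j, |B.1 i j - (A + D).1 i j| < ε := by
    rw [eventually_all]; intro i
    rw [eventually_all]; intro j
    have hcont : Continuous fun B : SymMat n => |B.1 i j - (A + D).1 i j| :=
      ((continuous_subtype_val.matrix_elem i j).sub continuous_const).abs
    refine hcont.continuousAt.eventually_lt continuousAt_const ?_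
    simpa using hεpos
  filter_upwards [hev] with B hB
  have hBA : B = A + (B - A) := by abel
  rw [hBA]
  refine F.f1 A hA _ (Matrix.PosSemidef.of_dotProduct_mulVec_nonneg (B - A).2 fun v => ?_)
  have h1 := hD (WithLp.toLp 2 v)
  rw [EuclideanSpace.real_norm_sq_eq] at h1
  simp only at h1
  have h2 : star v ⬝ᵥ ((B - A).1.mulVec v) = ∑ i, ∑ j, v i * D.1 i j * v j +
      ∑ i, ∑ j, v i * (B.1 i j - (A + D).1 i j) * v j := by
    rw [← Finset.sum_add_distrib]
    simp only [dotProduct, Matrix.mulVec, Pi.star_apply, star_trivial]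
    refine Finset.sum_congr rfl fun i _ => ?_
    rw [Finset.mul_sum, ← Finset.sum_add_distrib]
    refine Finset.sum_congr rfl fun j _ => ?_
    rw [AddSubgroup.coe_sub, Matrix.sub_apply, AddSubgroup.coe_add, Matrix.add_apply]
    ring
  have h3 : -(ε * n * ∑ i, v i ^ 2) ≤ ∑ i, ∑ j, v i * (B.1 i j - (A + D).1 i j) * v j := by
    have h4 : ∀ i j, -(ε * ((v i ^ 2 + v j ^ 2) / 2)) ≤
        v i * (B.1 i j - (A + D).1 i j) * v j := by
      intro i j
      refine neg_le_of_abs_le ?_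
      rw [abs_mul, abs_mul]
      have h5 : |v i| * |v j| ≤ (v i ^ 2 + v j ^ 2) / 2 := by
        rw [← sq_abs (v i), ← sq_abs (v j)]
        nlinarith [sq_nonneg (|v i| - |v j|)]
      calc |v i| * |B.1 i j - (A + D).1 i j| * |v j|
          = |B.1 i j - (A + D).1 i j| * (|v i| * |v j|) := by ring
        _ ≤ ε * ((v i ^ 2 + v j ^ 2) / 2) := by
            gcongr
            exact (hB i j).le
    refine le_trans (le_of_eq ?_) (Finset.sum_le_sum fun i _ => Finset.sum_le_sum fun j _ => h4 i j)
    simp only [Finset.sum_neg_distrib, ← Finset.mul_sum, ← Finset.sum_div,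
      Finset.sum_add_distrib, Finset.sum_const, Finset.card_univ, Fintype.card_fin, nsmul_eq_mul]
    ring
  have h6 : ε * n * ∑ i, v i ^ 2 ≤ c * ∑ i, v i ^ 2 := by
    gcongr
  rw [h2]
  linarith

end Hessian

section Comparison

open scoped RealInnerProductSpace

/-- A form of the comparison principle: a slightly convex perturbation of `t V - H` has no interior
maximum at a point where the subharmonic function `V` is larger than the truncation level `b`. -/
theorem ConeSubequation.not_isMax_sub (F : ConeSubequation n) {X : Set (EucSp n)} (hX : IsOpen X)
    {v : EucSp n → EReal} {H V : EucSp n → ℝ} (hv : FSubharmonicOn F.carrier X v)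
    (hH : FSubharmonicOn (dualSet F.carrier) X fun y => -(H y : EReal))
    (hHc : ContinuousOn H X) (hV : UpperSemicontinuousOn V X) {b t δ : ℝ} (ht : 0 < t) (hδ : 0 < δ)
    (hvV : ∀ y ∈ X, v y ≤ (V y : EReal)) (hvVb : ∀ y ∈ X, b < V y → v y = (V y : EReal))
    {y₀ : EucSp n} (hy₀ : y₀ ∈ X) (hb : b < V y₀)
    (hmax : ∀ y ∈ X, t * V y - H y + δ * ‖y‖ ^ 2 ≤ t * V y₀ - H y₀ + δ * ‖y₀‖ ^ 2) : False := by
  set g : EucSp n → ℝ := fun y => δ * ‖y‖ ^ 2 - δ / 2 * ‖y - y₀‖ ^ 2 with hg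
  have hgc : Continuous g := by fun_prop
  set τ : ℝ := t * (V y₀ - b) / 2 with hτ
  have hτpos : 0 < τ := by
    have : 0 < V y₀ - b := by linarith
    positivity
  have hnear : ∀ᶠ y in 𝓝 y₀, y ∈ X ∧ g y < g y₀ + τ := by
    refine (hX.eventually_mem hy₀).and (hgc.continuousAt.eventually_lt continuousAt_const ?_)
    linarith
  obtain ⟨R, hR, hball⟩ := Metric.nhds_basis_closedBall.eventually_iff.1 hnear
  have hsub : Metric.closedBall y₀ R ⊆ X := fun y hy => (hball hy).1
  have husc : UpperSemicontinuousOn (fun y => t * V y + g y) (Metric.closedBall y₀ R) := by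
    refine UpperSemicontinuousOn.add ?_ hgc.continuousOn.upperSemicontinuousOn
    intro y hy c hc
    have hc' : V y < c / t := by rw [lt_div_iff₀ ht]; linarith
    filter_upwards [(hV.mono hsub) y hy _ hc'] with z hz
    rw [lt_div_iff₀ ht] at hz
    linarith
  obtain ⟨y, hy, z, hz, hτy, a, e, A, B, hA, hB, hAB⟩ := exists_quadratic_tests
    (u := fun y => t * V y + g y) (w := fun y => -H y) (κ := δ / 2) (τ := τ) (η := δ / 2)
    hR (by positivity) hτpos (by positivity) husc (hHc.mono hsub).neg (fun y hy => by
      have := hmax y (hsub hy)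
      simp only [hg, sub_self, norm_zero]
      linarith)
  have hyX := hsub (Metric.ball_subset_closedBall hy)
  have hzX := hsub (Metric.ball_subset_closedBall hz)
  have hVy : b < V y := by
    have h1 := (hball (Metric.ball_subset_closedBall hy)).2
    have h2 : t * b < t * V y := by
      have h3 : τ = t * V y₀ / 2 - t * b / 2 := by rw [hτ]; ring
      linarith
    exact lt_of_mul_lt_mul_left h2 ht.le
  have hmem1 : symMatOf (t⁻¹ • (A - δ • ContinuousLinearMap.id ℝ (EucSp n))) ∈ F.carrier := by
    refine hv.symMatOf_mem (a := t⁻¹ • (a - (2 * δ) • y + δ • (y - y₀))) hyX (hvVb y hyX hVy) ?_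
    filter_upwards [hA, hX.eventually_mem hyX] with y' hy' hy'X
    refine (hvV y' hy'X).trans (EReal.coe_le_coe_iff.2 ?_)
    set k := y' - y with hk
    have hyk : y' = y + k := by rw [hk]; abel
    have hg' : g y' - g y = ⟪(2 * δ) • y - δ • (y - y₀), k⟫ + δ / 2 * ‖k‖ ^ 2 := by
      have e1 : ‖y'‖ ^ 2 = ‖y‖ ^ 2 + 2 * ⟪y, k⟫ + ‖k‖ ^ 2 := by
        rw [hyk, norm_add_sq_real]
      have e2 : ‖y' - y₀‖ ^ 2 = ‖y - y₀‖ ^ 2 + 2 * ⟪y - y₀, k⟫ + ‖k‖ ^ 2 := by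
        rw [← norm_add_sq_real]; congr 2; rw [hyk]; abel
      simp only [hg, e1, e2, inner_sub_left, real_inner_smul_left]
      ring
    have key : t * V y' ≤ t * V y + ⟪a, k⟫ - ⟪(2 * δ) • y - δ • (y - y₀), k⟫
        + ⟪A k, k⟫ / 2 - δ / 2 * ‖k‖ ^ 2 := by linarith
    have e3 : V y + ⟪t⁻¹ • (a - (2 * δ) • y + δ • (y - y₀)), k⟫ +
        ⟪(t⁻¹ • (A - δ • ContinuousLinearMap.id ℝ (EucSp n))) k, k⟫ / 2 =
        (t * V y + ⟪a, k⟫ - ⟪(2 * δ) • y - δ • (y - y₀), k⟫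
        + ⟪A k, k⟫ / 2 - δ / 2 * ‖k‖ ^ 2) / t := by
      simp only [smul_apply, sub_apply, ContinuousLinearMap.id_apply, real_inner_smul_left,
        inner_sub_left, inner_add_left, real_inner_self_eq_norm_sq]
      field_simp
      ring
    rw [e3, le_div_iff₀ ht]
    linarith
  have hmem2 : symMatOf (A - δ • ContinuousLinearMap.id ℝ (EucSp n)) ∈ F.carrier := by
    have := F.f2 _ hmem1 t ht
    rwa [← symMatOf_smul, smul_smul, mul_inv_cancel₀ ht.ne', one_smul] at this
  have hmem3 : symMatOf B ∈ dualSet F.carrier := by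
    refine hH.symMatOf_mem (a := e) (c := -H z) hzX (by simp) ?_
    filter_upwards [hB] with z' hz'
    rw [← EReal.coe_neg]
    exact EReal.coe_le_coe_iff.2 hz'
  refine hmem3 ?_
  have hsum : -symMatOf B = symMatOf (A - δ • ContinuousLinearMap.id ℝ (EucSp n)) +
      symMatOf (δ • ContinuousLinearMap.id ℝ (EucSp n) - A - B) := by
    rw [← symMatOf_add, ← symMatOf_neg]
    congr 1
    abel
  rw [hsum]
  refine F.add_mem_interior hmem2 (half_pos hδ) fun k => ?_
  rw [sum_mul_symMatOf]
  simp only [smul_apply, sub_apply, ContinuousLinearMap.id_apply, real_inner_smul_left,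
    inner_sub_left, real_inner_self_eq_norm_sq]
  have := hAB k
  linarith

/-- A function with singularity at least as strong as `h` lies above `H / t` (up to constants)
near the singular point, for every `t > 1`. -/
lemma eventually_lt_of_liminf {F : ConeSubequation n} {U : Set (EucSp n)} {p : EucSp n}
    {h v : EucSp n → EReal} {H : EucSp n → ℝ} (hh : DPSingular F U p h) (hfin : h p ≠ ⊥)
    (hH : FiniteAsymp H h p) {r t : ℝ} (hvp : v p = (r : EReal)) (ht : 1 < t)
    (hv : (1 : EReal) ≤ liminf (fun y => (v y - v p) / (h y - h p)) (𝓝[≠] p)) :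
    ∀ᶠ y in 𝓝[≠] p, ((r + (H y - H p) / t : ℝ) : EReal) < v y := by
  have ht0 : 0 < t := by linarith
  have hti : t⁻¹ < 1 := inv_lt_one_of_one_lt₀ ht
  obtain ⟨c, hc1, hc2⟩ := exists_between hti
  have hct : 1 < c * t := by rwa [inv_lt_iff_one_lt_mul₀ ht0] at hc1
  have hlt : (c : EReal) < liminf (fun y => (v y - v p) / (h y - h p)) (𝓝[≠] p) :=
    lt_of_lt_of_le (by exact_mod_cast hc2) hv
  have hU : ∀ᶠ y in 𝓝[≠] p, y ∈ U := nhdsWithin_le_nhds (hh.isOpen'.mem_nhds hh.mem)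
  filter_upwards [eventually_lt_of_lt_liminf hlt, hU, self_mem_nhdsWithin,
    hH.eventually_lt_const hct] with y hy hyU hyp hHy
  have hpy := hh.strictMin y hyU hyp
  obtain ⟨a, ha⟩ : ∃ a : ℝ, h p = a :=
    ⟨_, (EReal.coe_toReal (hh.subh.2.1 p hh.mem) hfin).symm⟩
  obtain ⟨d, hd⟩ : ∃ d : ℝ, h y = d :=
    ⟨_, (EReal.coe_toReal (hh.subh.2.1 y hyU) (ne_bot_of_gt hpy)).symm⟩
  rw [ha, hd] at hpy hHy
  rw [ha, hd, hvp] at hy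
  have had : a < d := by exact_mod_cast hpy
  have hda : 0 < d - a := by linarith
  rw [EReal.toReal_coe, EReal.toReal_coe, div_lt_iff₀ hda] at hHy
  rw [← EReal.coe_sub, EReal.lt_div_iff (by exact_mod_cast hda) (EReal.coe_ne_top _)] at hy
  have h1 : (H y - H p) / t < c * (d - a) := by
    rw [div_lt_iff₀ ht0]; nlinarith
  induction hvy : v y with
  | bot => rw [hvy] at hy; simp at hy
  | top => exact EReal.coe_lt_top _
  | coe s =>
    rw [hvy] at hy
    have hs : c * (d - a) < s - r := by exact_mod_cast hy
    exact_mod_cast (by linarith : r + (H y - H p) / t < s)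

/-- A function asymptotically equivalent to a finite singularity has no test functions. -/
lemma noTestAt_of_finiteAsymp {F : ConeSubequation n} {U Ω : Set (EucSp n)} {p : EucSp n}
    {h : EucSp n → EReal} {H : EucSp n → ℝ} (hh : DPSingular F U p h) (hfin : h p ≠ ⊥)
    (hΩ : Ω ∈ 𝓝 p) (hH : FiniteAsymp H h p) : NoTestAt Ω (fun y => (H y : EReal)) p := by
  rintro ψ ⟨hψ, hle, heq⟩
  have hno : NoTestAt U h p := (hh.polarOrFinite.resolve_left hfin).2
  obtain ⟨a, ha⟩ : ∃ a : ℝ, h p = a :=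
    ⟨_, (EReal.coe_toReal (hh.subh.2.1 p hh.mem) hfin).symm⟩
  have hHp : H p = ψ p := EReal.coe_eq_coe_iff.1 heq
  refine hno (fun y => a + 2 * (ψ y - ψ p)) ⟨?_, ?_, by simp [ha]⟩
  · exact contDiffAt_const.add (contDiffAt_const.mul (hψ.sub contDiffAt_const))
  · rw [nhdsWithin_eq_nhds.2 hΩ] at hle
    have hev := eventually_nhdsWithin_iff.1 (hH.eventually_const_lt (by norm_num : (1 / 2 : ℝ) < 1))
    rw [nhdsWithin_eq_nhds.2 (hh.isOpen'.mem_nhds hh.mem)]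
    filter_upwards [hle, hev, hh.isOpen'.mem_nhds hh.mem] with y hy hHy hyU
    by_cases hyp : y = p
    · subst hyp; simp [ha]
    have hpy := hh.strictMin y hyU hyp
    obtain ⟨d, hd⟩ : ∃ d : ℝ, h y = d :=
      ⟨_, (EReal.coe_toReal (hh.subh.2.1 y hyU) (ne_bot_of_gt hpy)).symm⟩
    have hHy := hHy hyp
    rw [ha, hd] at hpy hHy
    have had : a < d := by exact_mod_cast hpy
    have hda : 0 < d - a := by linarith
    rw [EReal.toReal_coe, EReal.toReal_coe, lt_div_iff₀ hda] at hHy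
    have hy' : H y ≤ ψ y := by exact_mod_cast hy
    rw [hd]
    exact_mod_cast (by linarith : d ≤ a + 2 * (ψ y - ψ p))

lemma ConeSubequation.pos_dim (F : ConeSubequation n) : 0 < n := by
  rcases Nat.eq_zero_or_pos n with rfl | hn
  · exfalso
    obtain ⟨A, hA⟩ := F.nonempty'
    exact F.proper' (Set.eq_univ_of_forall fun B => Subsingleton.elim A B ▸ hA)
  · exact hn

lemma ConeSubequation.nhdsNE_neBot (F : ConeSubequation n) (p : EucSp n) : (𝓝[≠] p).NeBot := by
  have : Nonempty (Fin n) := ⟨⟨0, F.pos_dim⟩⟩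
  exact Module.punctured_nhds_neBot ℝ (EucSp n) p

lemma liminf_eq_one_of_finiteAsymp {F : ConeSubequation n} {U : Set (EucSp n)} {p : EucSp n}
    {h : EucSp n → EReal} {H : EucSp n → ℝ} (hh : DPSingular F U p h) (hfin : h p ≠ ⊥)
    (hH : FiniteAsymp H h p) :
    liminf (fun y => ((H y : EReal) - (H p : EReal)) / (h y - h p)) (𝓝[≠] p) = 1 := by
  have := F.nhdsNE_neBot p
  refine Tendsto.liminf_eq ?_
  have h1 : Tendsto (fun y => (((H y - H p) / ((h y).toReal - (h p).toReal) : ℝ) : EReal))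
      (𝓝[≠] p) (𝓝 ((1 : ℝ) : EReal)) :=
    (continuous_coe_real_ereal.tendsto 1).comp hH
  rw [EReal.coe_one] at h1
  refine h1.congr' ?_
  have hU : ∀ᶠ y in 𝓝[≠] p, y ∈ U := nhdsWithin_le_nhds (hh.isOpen'.mem_nhds hh.mem)
  filter_upwards [hU, self_mem_nhdsWithin] with y hyU hyp
  have hpy := hh.strictMin y hyU hyp
  rw [EReal.coe_div, EReal.coe_sub, EReal.coe_sub,
    EReal.coe_toReal (hh.subh.2.1 p hh.mem) hfin,
    EReal.coe_toReal (hh.subh.2.1 y hyU) (ne_bot_of_gt hpy)]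

end Comparison

section Truncation

lemma coe_toReal_max {v : EReal} (hv : v ≠ ⊤) (b : ℝ) :
    ((max v b).toReal : EReal) = max v b :=
  EReal.coe_toReal (by simp [max_eq_iff, hv])
    (ne_bot_of_gt (lt_of_lt_of_le (EReal.bot_lt_coe b) (le_max_right _ _)))

lemma UpperSemicontinuousOn.toReal_max {X : Set (EucSp n)} {v : EucSp n → EReal}
    (hv : UpperSemicontinuousOn v X) (hv' : ∀ y ∈ X, v y ≠ ⊤) (b : ℝ) :
    UpperSemicontinuousOn (fun y => (max (v y) (b : EReal)).toReal) X := by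
  intro y hy c hc
  have hc' : max (v y) (b : EReal) < c := by
    rw [← coe_toReal_max (hv' y hy)]
    exact_mod_cast hc
  rw [max_lt_iff] at hc'
  filter_upwards [hv y hy _ hc'.1, self_mem_nhdsWithin] with z hz hzX
  have : max (v z) (b : EReal) < c := max_lt hz hc'.2
  rw [← coe_toReal_max (hv' z hzX)] at this
  exact_mod_cast this

end Truncation

/-- The comparison principle with singularities. -/
theorem le_of_liminf_of_finiteAsymp {k : ℕ} (F : ConeSubequation n)
    {Ω : Set (EucSp n)} (hΩo : IsOpen Ω) (hΩb : Bornology.IsBounded Ω)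
    {x : Fin k → EucSp n} (hx : ∀ j, x j ∈ Ω)
    {U : Fin k → Set (EucSp n)} {h : Fin k → EucSp n → EReal}
    (hh : ∀ j, DPSingular F (U j) (x j) (h j)) (hfin : ∀ j, h j (x j) ≠ ⊥)
    {H : EucSp n → ℝ} (hHc : ContinuousOn H (closure Ω))
    (hHharm : FSubharmonicOn (dualSet F.carrier) (Ω \ Set.range x) fun y => -(H y : EReal))
    (hHasymp : ∀ j, FiniteAsymp H (h j) (x j))
    {v : EucSp n → EReal} (hvu : UpperSemicontinuousOn v (closure Ω))
    (hvt : ∀ y ∈ closure Ω, v y ≠ ⊤) (hvF : FSubharmonicOn F.carrier Ω v)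
    (hvb : ∀ y ∈ frontier Ω, v y ≤ (H y : EReal))
    (hvl : ∀ j, (1 : EReal) ≤ liminf (fun y => (v y - v (x j)) / (h j y - h j (x j))) (𝓝[≠] x j))
    {y : EucSp n} (hy : y ∈ closure Ω) : v y ≤ (H y : EReal) := by
  by_contra! hlt
  have hK : IsCompact (closure Ω) := hΩb.isCompact_closure
  obtain ⟨m, hm⟩ := hK.exists_bound_of_continuousOn hHc
  obtain ⟨R, hR⟩ := hK.exists_bound_of_continuousOn (f := fun y : EucSp n => ‖y‖ ^ 2)
    (by fun_prop)
  have hm' : ∀ z ∈ closure Ω, -m ≤ H z ∧ H z ≤ m := fun z hz => abs_le.1 (hm z hz)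
  have hm0 : 0 ≤ m := (norm_nonneg _).trans (hm y hy)
  set V : EucSp n → ℝ := fun z => (max (v z) ((-m : ℝ) : EReal)).toReal with hV
  have hVu : UpperSemicontinuousOn V (closure Ω) := hvu.toReal_max hvt (-m)
  have hVmax : ∀ z ∈ closure Ω, (V z : EReal) = max (v z) ((-m : ℝ) : EReal) :=
    fun z hz => coe_toReal_max (hvt z hz) _
  have hvV : ∀ z ∈ closure Ω, v z ≤ (V z : EReal) := fun z hz => by
    rw [hVmax z hz]; exact le_max_left _ _
  have hvVb : ∀ z ∈ closure Ω, -m < V z → v z = (V z : EReal) := fun z hz hb => by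
    have hb' : ((-m : ℝ) : EReal) < (V z : EReal) := by exact_mod_cast hb
    rw [hVmax z hz] at hb' ⊢
    rw [lt_max_iff] at hb'
    exact (max_eq_left (hb'.resolve_right (lt_irrefl _)).le).symm
  have hVle : ∀ z ∈ closure Ω, v z ≤ (H z : EReal) → V z ≤ H z := fun z hz hvz => by
    have : (V z : EReal) ≤ (H z : EReal) := by
      rw [hVmax z hz]
      exact max_le hvz (by exact_mod_cast (hm' z hz).1)
    exact_mod_cast this
  have hγ : 0 < V y - H y := by
    have : (H y : EReal) < (V y : EReal) := hlt.trans_le (hvV y hy)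
    have : H y < V y := by exact_mod_cast this
    linarith
  set s : ℝ := (V y - H y) / (2 * m + 1) with hs
  have hs0 : 0 < s := by positivity
  have hsm : 2 * s * m < V y - H y := by
    have : s * (2 * m + 1) = V y - H y := by rw [hs]; field_simp
    nlinarith
  set G : EucSp n → ℝ := fun z => (1 + s) * V z - H z with hG
  have hGlow : ∀ z ∈ closure Ω, V z ≤ H z → G z ≤ s * m := fun z hz hz' => by
    have h1 := (hm' z hz).2
    have h2 : G z ≤ s * H z := by simp only [hG]; nlinarith
    nlinarith
  have hGy : s * m < G y := by
    have h1 := (hm' y hy).1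
    have h2 : G y = (1 + s) * (V y - H y) + s * H y := by simp only [hG]; ring
    nlinarith
  have hVmul : UpperSemicontinuousOn (fun z => (1 + s) * V z) (closure Ω) := by
    intro z hz c hc
    have hc' : V z < c / (1 + s) := by rw [lt_div_iff₀ (by linarith)]; linarith
    filter_upwards [hVu z hz _ hc'] with w hw
    rw [lt_div_iff₀ (by linarith)] at hw
    linarith
  have hGu : UpperSemicontinuousOn G (closure Ω) :=
    hVmul.add hHc.neg.upperSemicontinuousOn
  obtain ⟨p, hp, hpmax⟩ := hGu.exists_isMaxOn ⟨y, hy⟩ hK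
  have hGp : s * m < G p := hGy.trans_le (hpmax hy)
  have hbad : ∀ z ∈ closure Ω, z ∈ frontier Ω ∪ Set.range x → G z < G p := by
    rintro z hz (hzf | ⟨j, rfl⟩)
    · exact (hGlow z hz (hVle z hz (hvb z hzf))).trans_lt hGp
    · by_contra! hge
      have hVH : H (x j) < V (x j) := by
        by_contra! hle
        exact (hge.trans (hGlow _ hz hle)).not_gt hGp
      have hvx := hvVb _ hz ((hm' _ hz).1.trans_lt hVH)
      have := F.nhdsNE_neBot (x j)
      have hev := eventually_lt_of_liminf (hh j) (hfin j) (hHasymp j) hvx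
        (by linarith : 1 < 1 + s) (hvl j)
      have hΩn : ∀ᶠ w in 𝓝[≠] x j, w ∈ Ω := nhdsWithin_le_nhds (hΩo.mem_nhds (hx j))
      obtain ⟨w, hw, hwΩ⟩ := (hev.and hΩn).exists
      have hwc := subset_closure hwΩ
      have h1 : V (x j) + (H w - H (x j)) / (1 + s) < V w := by
        have := hw.trans_le (hvV w hwc)
        exact_mod_cast this
      have h2 : (H w - H (x j)) / (1 + s) < V w - V (x j) := by linarith
      rw [div_lt_iff₀ (by linarith)] at h2
      have h3 : G w ≤ G p := hpmax hwc
      simp only [hG] at h3 hge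
      linarith
  obtain ⟨M, hM, hMbad⟩ : ∃ M < G p, ∀ z ∈ closure Ω, z ∈ frontier Ω ∪ Set.range x → G z ≤ M := by
    have hBc : IsCompact (frontier Ω ∪ Set.range x) :=
      (hK.of_isClosed_subset isClosed_frontier frontier_subset_closure).union
        (Set.finite_range x).isCompact
    have hBs : frontier Ω ∪ Set.range x ⊆ closure Ω :=
      Set.union_subset frontier_subset_closure
        (Set.range_subset_iff.2 fun j => subset_closure (hx j))
    rcases (frontier Ω ∪ Set.range x).eq_empty_or_nonempty with he | hne
    · exact ⟨G p - 1, by linarith, fun z _ hz => by simp [he] at hz⟩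
    · obtain ⟨q, hq, hqmax⟩ := (hGu.mono hBs).exists_isMaxOn hne hBc
      exact ⟨G q, hbad q (hBs hq) hq, fun z _ hz => hqmax hz⟩
  have hR' : ∀ z ∈ closure Ω, ‖z‖ ^ 2 ≤ R := fun z hz => (le_abs_self _).trans (hR z hz)
  have hR0 : 0 ≤ R := (sq_nonneg _).trans (hR' y hy)
  set δ : ℝ := min (G p - M) (G p - s * m) / (R + 1) with hδ
  have hmin : 0 < min (G p - M) (G p - s * m) := lt_min (by linarith) (by linarith)
  have hδ0 : 0 < δ := by positivity
  have hδR : δ * R < min (G p - M) (G p - s * m) := by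
    have : δ * (R + 1) = min (G p - M) (G p - s * m) := by rw [hδ]; field_simp
    linarith
  rw [lt_min_iff] at hδR
  have hGδ : UpperSemicontinuousOn (fun z => G z + δ * ‖z‖ ^ 2) (closure Ω) :=
    hGu.add (Continuous.continuousOn (by fun_prop)).upperSemicontinuousOn
  obtain ⟨q, hq, hqmax⟩ := hGδ.exists_isMaxOn ⟨y, hy⟩ hK
  have hqp : G p ≤ G q + δ * R := by
    have h1 : G p + δ * ‖p‖ ^ 2 ≤ G q + δ * ‖q‖ ^ 2 := hqmax hp
    have h2 : δ * ‖q‖ ^ 2 ≤ δ * R := by gcongr; exact hR' q hq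
    have h3 : 0 ≤ δ * ‖p‖ ^ 2 := by positivity
    linarith
  have hqbad : q ∉ frontier Ω ∪ Set.range x := fun hqb => by
    have := hMbad q hq hqb
    linarith [hδR.1]
  have hqX : q ∈ Ω \ Set.range x := by
    refine ⟨?_, fun hqr => hqbad (Or.inr hqr)⟩
    by_contra hqΩ
    exact hqbad (Or.inl (by rw [hΩo.frontier_eq]; exact ⟨hq, hqΩ⟩))
  have hqV : -m < V q := by
    by_contra! hle
    have := hGlow q hq (hle.trans (hm' q hq).1)
    linarith [hδR.2]
  have hXs : Ω \ Set.range x ⊆ closure Ω := Set.sdiff_subset.trans subset_closure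
  have hXo : IsOpen (Ω \ Set.range x) := hΩo.sdiff (Set.finite_range x).isClosed
  have hvX : FSubharmonicOn F.carrier (Ω \ Set.range x) v := by
    refine ⟨hvF.1.mono Set.sdiff_subset, fun z hz => hvF.2.1 z hz.1, fun z hz ψ hψ => ?_⟩
    refine hvF.2.2 z hz.1 ψ ⟨hψ.1, ?_, hψ.2.2⟩
    rw [hΩo.nhdsWithin_eq hz.1, ← hXo.nhdsWithin_eq hz]
    exact hψ.2.1
  exact F.not_isMax_sub hXo hvX hHharm (hHc.mono hXs) (hVu.mono hXs) (b := -m) (t := 1 + s)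
    (by linarith) hδ0 (fun z hz => hvV z (hXs hz)) (fun z hz => hvVb z (hXs hz)) hqX hqV
    fun z hz => hqmax (hXs hz)

/-- Corollary 5.5, uniqueness in the finite case: any solution H of the
(DPPS) with finite-type singularities is the Perron function of the family 𝓕. -/
theorem dirichlet_singularities_stmt8 {n k : ℕ} (F : ConeSubequation n)
    (Ω : Set (EucSp n)) (hΩ : IsBoundedDomain Ω)
    (x : Fin k → EucSp n) (hx : ∀ j, x j ∈ Ω)
    (φ : EucSp n → ℝ) (hφ : ContinuousOn φ (frontier Ω))
    (U : Fin k → Set (EucSp n)) (h : Fin k → EucSp n → EReal)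
    (hh : ∀ j, DPSingular F (U j) (x j) (h j)) (hfin : ∀ j, h j (x j) ≠ ⊥)
    (𝓕 : Set (EucSp n → EReal))
    (h𝓕 : 𝓕 = {v : EucSp n → EReal |
      UpperSemicontinuousOn v (closure Ω) ∧ (∀ y ∈ closure Ω, v y ≠ ⊤) ∧
      FSubharmonicOn F.carrier Ω v ∧ (∀ y ∈ frontier Ω, v y ≤ (φ y : EReal)) ∧
      ∀ j, (1 : EReal) ≤
        Filter.liminf (fun y => (v y - v (x j)) / (h j y - h j (x j))) (𝓝[≠] x j)})
    (H : EucSp n → ℝ)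
    (hHc : ContinuousOn H (closure Ω))
    (hHharm : FHarmonicOn F (Ω \ Set.range x) (fun y => (H y : EReal)))
    (hHbd : ∀ y ∈ frontier Ω, H y = φ y)
    (hHasymp : ∀ j, FiniteAsymp H (h j) (x j)) :
    ∀ y ∈ closure Ω, (H y : EReal) = ⨆ v ∈ 𝓕, v y := by
  intro y hy
  subst h𝓕
  refine le_antisymm ?_ (iSup₂_le fun v hv => ?_)
  · refine le_iSup₂ (f := fun (v : EucSp n → EReal) _ => v y) (fun z => (H z : EReal)) ?_
    have hHu : UpperSemicontinuousOn (fun z => (H z : EReal)) (closure Ω) :=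
      (continuous_coe_real_ereal.comp_continuousOn hHc).upperSemicontinuousOn
    refine ⟨hHu, fun _ _ => EReal.coe_ne_top _, ⟨hHu.mono subset_closure,
      fun _ _ => EReal.coe_ne_top _, fun z hz ψ hψ => ?_⟩,
      fun z hz => EReal.coe_le_coe_iff.2 (hHbd z hz).le,
      fun j => (liminf_eq_one_of_finiteAsymp (hh j) (hfin j) (hHasymp j)).ge⟩
    by_cases hzx : z ∈ Set.range x
    · obtain ⟨j, rfl⟩ := hzx
      exact (noTestAt_of_finiteAsymp (hh j) (hfin j) (hΩ.1.mem_nhds hz) (hHasymp j) ψ hψ).elim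
    · exact hHharm.1.2.2 z ⟨hz, hzx⟩ ψ
        ⟨hψ.1, hψ.2.1.filter_mono (nhdsWithin_mono z Set.sdiff_subset), hψ.2.2⟩
  · obtain ⟨hvu, hvt, hvF, hvb, hvl⟩ := hv
    exact le_of_liminf_of_finiteAsymp F hΩ.1 hΩ.2.2 hx hh hfin hHc hHharm.2 hHasymp hvu hvt hvF
      (fun z hz => by rw [hHbd z hz]; exact hvb z hz) hvl hy
end
end

section
/- Let F be a cone subequation on ℝⁿ satisfying condition (F3), let Ω ⊂ ℝⁿ be a bounded domain with smooth strictly F-convex boundary, let φ ∈ C(∂Ω), and let x₁,…,x_k ∈ Ω. Let ψ : Ω̄ → [−∞,∞) be continuous and F-subharmonic on Ω with ψ ≤ φ on ∂Ω, such that either (polar case) ψ takes the value −∞ exactly at the points x₁,…,x_k, or (finite case) ψ is finite-valued and each x_j is a strict local minimum point of ψ at which ψ admits no test functions. Fix r > 0 so small that the closed balls B̄_r(x_j), j = 1,…,k, are mutually disjoint and contained in Ω, and set Ω_r = Ω ∖ ⋃_j B̄_r(x_j). Then there exists H_r ∈ C(Ω̄_r), F-harmonic on Ω_r, with H_r = ψ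 on each sphere ∂B_r(x_j) and H_r = φ on ∂Ω; moreover H_r is the Perron function H_r(x) = sup{u(x) : u upper semicontinuous on Ω̄_r, F-subharmonic on Ω_r, u ≤ ψ on ⋃_j ∂B_r(x_j), u ≤ φ on ∂Ω}. -/
open scoped Topology Classical
open Filter

noncomputable section

variable {n : ℕ}

/-! ### Hessians of `C²` functions -/

/-- The symmetric part of the Hessian matrix; it is the Hessian itself for `C²` functions. -/
def symHess (f : EucSp n → ℝ) (x : EucSp n) : SymMat n :=
  selfAdjointPart ℝ (hessMatrix f x)

lemma hessMatrix_apply (f : EucSp n → ℝ) (x : EucSp n) (i j : Fin n) :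
    hessMatrix f x i j =
      fderiv ℝ (fderiv ℝ f) x (EuclideanSpace.single i 1) (EuclideanSpace.single j 1) := by
  simp [hessMatrix, iteratedFDeriv_two_apply]

lemma hessMatrix_eq_of_hasFDerivAt {f : EucSp n → ℝ} {x : EucSp n}
    {f' : EucSp n → EucSp n →L[ℝ] ℝ} {f'' : EucSp n →L[ℝ] EucSp n →L[ℝ] ℝ}
    (h : ∀ᶠ y in 𝓝 x, HasFDerivAt f (f' y) y) (h' : HasFDerivAt f' f'' x) (i j : Fin n) :
    hessMatrix f x i j = f'' (EuclideanSpace.single i 1) (EuclideanSpace.single j 1) := by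
  have : fderiv ℝ f =ᶠ[𝓝 x] f' := h.mono fun y hy => hy.fderiv
  rw [hessMatrix_apply, this.fderiv_eq, h'.fderiv]

lemma hasFDerivAt_fderiv {f : EucSp n → ℝ} {x : EucSp n} (hf : ContDiffAt ℝ 2 f x) :
    HasFDerivAt (fderiv ℝ f) (fderiv ℝ (fderiv ℝ f) x) x :=
  ((hf.fderiv_right (m := 1) (by norm_num)).differentiableAt one_ne_zero).hasFDerivAt

lemma eventually_hasFDerivAt {f : EucSp n → ℝ} {x : EucSp n} (hf : ContDiffAt ℝ 2 f x) :
    ∀ᶠ y in 𝓝 x, HasFDerivAt f (fderiv ℝ f y) y :=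
  (hf.eventually (by simp)).mono fun _ hy => (hy.differentiableAt two_ne_zero).hasFDerivAt

lemma hessMatrix_isSelfAdjoint {f : EucSp n → ℝ} {x : EucSp n} (hf : ContDiffAt ℝ 2 f x) :
    IsSelfAdjoint (hessMatrix f x) := by
  rw [isSelfAdjoint_iff]
  ext i j
  simpa [Matrix.star_apply, hessMatrix_apply] using
    (hf.isSymmSndFDerivAt (by simp)) (EuclideanSpace.single j 1) (EuclideanSpace.single i 1)

lemma coe_symHess {f : EucSp n → ℝ} {x : EucSp n} (hf : ContDiffAt ℝ 2 f x) :
    (symHess f x : Matrix (Fin n) (Fin n) ℝ) = hessMatrix f x :=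
  (hessMatrix_isSelfAdjoint hf).coe_selfAdjointPart_apply ℝ

lemma hessMatrix_mem_image_iff {f : EucSp n → ℝ} {x : EucSp n} (hf : ContDiffAt ℝ 2 f x)
    {S : Set (SymMat n)} : hessMatrix f x ∈ Subtype.val '' S ↔ symHess f x ∈ S := by
  rw [← coe_symHess hf]
  exact Subtype.val_injective.mem_set_image

lemma hessMatrix_congr {f g : EucSp n → ℝ} {x : EucSp n} (h : f =ᶠ[𝓝 x] g) :
    hessMatrix f x = hessMatrix g x := by
  ext i j
  rw [hessMatrix_apply, hessMatrix_apply, h.fderiv.fderiv_eq]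

lemma hessMatrix_add {f g : EucSp n → ℝ} {x : EucSp n} (hf : ContDiffAt ℝ 2 f x)
    (hg : ContDiffAt ℝ 2 g x) :
    hessMatrix (fun y => f y + g y) x = hessMatrix f x + hessMatrix g x := by
  ext i j
  rw [hessMatrix_eq_of_hasFDerivAt (f := fun y => f y + g y)
    (f' := fun y => fderiv ℝ f y + fderiv ℝ g y)
    ((eventually_hasFDerivAt hf).and (eventually_hasFDerivAt hg) |>.mono
      fun y hy => hy.1.add hy.2) ((hasFDerivAt_fderiv hf).add (hasFDerivAt_fderiv hg))]
  simp [hessMatrix_apply]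

lemma hessMatrix_const (c : ℝ) (x : EucSp n) : hessMatrix (fun _ => c) x = 0 := by
  ext i j
  rw [hessMatrix_eq_of_hasFDerivAt (f' := fun _ => 0)
    (Eventually.of_forall fun y => hasFDerivAt_const c y) (hasFDerivAt_const _ x)]
  simp

/-- The Hessian of a composition `χ ∘ f` with a function of one variable. -/
lemma hessMatrix_comp {f : EucSp n → ℝ} {χ χ' : ℝ → ℝ} {χ'' : ℝ} {x : EucSp n}
    (hf : ContDiffAt ℝ 2 f x) (hχ : ∀ t, HasDerivAt χ (χ' t) t) (hχ' : HasDerivAt χ' χ'' (f x)) :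
    hessMatrix (fun y => χ (f y)) x = χ' (f x) • hessMatrix f x +
      χ'' • Matrix.of fun i j => fderiv ℝ f x (EuclideanSpace.single i 1) *
        fderiv ℝ f x (EuclideanSpace.single j 1) := by
  ext i j
  have h1 : HasFDerivAt (fun y => χ' (f y)) (χ'' • fderiv ℝ f x) x :=
    hχ'.comp_hasFDerivAt x (hf.differentiableAt two_ne_zero).hasFDerivAt
  rw [hessMatrix_eq_of_hasFDerivAt (f := fun y => χ (f y)) (f' := fun y => χ' (f y) • fderiv ℝ f y)
    ((eventually_hasFDerivAt hf).mono fun y hy => (hχ (f y)).comp_hasFDerivAt y hy)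
    (h1.smul (hasFDerivAt_fderiv hf))]
  simp [hessMatrix_apply, mul_assoc]

lemma hessMatrix_const_mul {f : EucSp n → ℝ} {x : EucSp n} (hf : ContDiffAt ℝ 2 f x) (c : ℝ) :
    hessMatrix (fun y => c * f y) x = c • hessMatrix f x := by
  rw [hessMatrix_comp (χ := fun t => c * t) (χ' := fun _ => c) (χ'' := 0) hf
    (fun t => by simpa using (hasDerivAt_id t).const_mul c) (hasDerivAt_const _ _)]
  simp

lemma hasFDerivAt_norm_sub_sq (c y : EucSp n) :
    HasFDerivAt (fun y => ‖y - c‖ ^ 2) (2 • innerSL ℝ (y - c)) y := by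
  simpa using ((hasFDerivAt_id y).sub_const c).norm_sq

lemma contDiff_norm_sub_sq (c : EucSp n) {m : WithTop ℕ∞} :
    ContDiff ℝ m (fun y : EucSp n => ‖y - c‖ ^ 2) :=
  (contDiff_id.sub contDiff_const).norm_sq ℝ

lemma hessMatrix_norm_sub_sq (c x : EucSp n) :
    hessMatrix (fun y => ‖y - c‖ ^ 2) x = (2 : ℝ) • 1 := by
  ext i j
  have h : HasFDerivAt (fun y : EucSp n => 2 • innerSL ℝ (y - c)) (2 • innerSL ℝ) x :=
    (((innerSL ℝ (E := EucSp n)).hasFDerivAt).comp x ((hasFDerivAt_id x).sub_const c)).const_smul 2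
  rw [hessMatrix_eq_of_hasFDerivAt (Eventually.of_forall fun y => hasFDerivAt_norm_sub_sq c y) h]
  change 2 • inner ℝ (EuclideanSpace.single i (1 : ℝ)) (EuclideanSpace.single j (1 : ℝ)) = _
  simp [Matrix.one_apply, EuclideanSpace.inner_single_left]

lemma continuousAt_symHess {f : EucSp n → ℝ} {x : EucSp n} (hf : ContDiffAt ℝ 2 f x) :
    ContinuousAt (symHess f) x := by
  have h : ContinuousAt (fun y => hessMatrix f y) x := by
    refine continuousAt_pi.2 fun i => continuousAt_pi.2 fun j => ?_
    simp only [hessMatrix_apply]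
    have h2 : ContinuousAt (fderiv ℝ (fderiv ℝ f)) x :=
      ((hf.fderiv_right (m := 1) (by norm_num)).fderiv_right (m := 0) (by norm_num)).continuousAt
    exact (h2.clm_apply continuousAt_const).clm_apply continuousAt_const
  exact (continuous_selfAdjointPart ℝ (Matrix (Fin n) (Fin n) ℝ)).continuousAt.comp h

lemma hessMatrix_comp_add (f : EucSp n → ℝ) (x h : EucSp n) :
    hessMatrix (fun y => f (y + h)) x = hessMatrix f (x + h) := by
  ext i j
  simp [hessMatrix, iteratedFDeriv_comp_add_right]

lemma eucSp_eq_sum (v : EucSp n) : v = ∑ i, v i • EuclideanSpace.single i (1 : ℝ) := by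
  ext j
  simp [Pi.single_apply]

lemma dotProduct_hessMatrix (f : EucSp n → ℝ) (x : EucSp n) (v : Fin n → ℝ) :
    v ⬝ᵥ (hessMatrix f x).mulVec v =
      fderiv ℝ (fderiv ℝ f) x (WithLp.toLp 2 v) (WithLp.toLp 2 v) := by
  conv_rhs => rw [eucSp_eq_sum (WithLp.toLp 2 v)]
  simp only [map_sum, map_smul, sum_apply, smul_apply,
    smul_eq_mul, dotProduct, Matrix.mulVec, hessMatrix_apply, Finset.mul_sum]
  rw [Finset.sum_comm]
  exact Finset.sum_congr rfl fun i _ => Finset.sum_congr rfl fun j _ => by ring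

/-- The Hessian is positive semidefinite at a local minimum. -/
lemma IsLocalMin.posSemidef_hessMatrix {f : EucSp n → ℝ} {x : EucSp n} (h : IsLocalMin f x)
    (hf : ContDiffAt ℝ 2 f x) : (hessMatrix f x).PosSemidef := by
  refine Matrix.PosSemidef.of_dotProduct_mulVec_nonneg (hessMatrix_isSelfAdjoint hf) fun v => ?_
  rw [star_trivial, dotProduct_hessMatrix]
  set w : EucSp n := WithLp.toLp 2 v
  set γ : ℝ → EucSp n := fun t => x + t • w
  have hγ : ∀ t, HasDerivAt γ w t := fun t => by
    simpa [γ] using ((hasDerivAt_id t).smul_const w).const_add x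
  have hγ0 : γ 0 = x := by simp [γ]
  have hγc : Tendsto γ (𝓝 0) (𝓝 x) := by
    simpa only [ContinuousAt, hγ0] using (hγ 0).continuousAt
  have hd : ∀ᶠ t in 𝓝 0, deriv (f ∘ γ) t = fderiv ℝ f (γ t) w :=
    (hγc.eventually (eventually_hasFDerivAt hf)).mono fun t ht =>
      (ht.comp_hasDerivAt t (hγ t)).deriv
  have hdd : deriv (deriv (f ∘ γ)) 0 = fderiv ℝ (fderiv ℝ f) x w w := by
    rw [EventuallyEq.deriv_eq hd]
    have h2 := hasFDerivAt_fderiv hf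
    rw [← hγ0] at h2
    have h3 := (h2.comp_hasDerivAt (0 : ℝ) (hγ 0)).clm_apply (hasDerivAt_const (0 : ℝ) w)
    rw [hγ0] at h3
    simpa using h3.deriv
  have hmin : IsLocalMin (f ∘ γ) 0 := by
    refine (hγc.eventually h).mono fun t ht => ?_
    simpa [hγ0] using ht
  have hcont : ContinuousAt (f ∘ γ) 0 :=
    ContinuousAt.comp (by rw [hγ0]; exact hf.continuousAt) (hγ 0).continuousAt
  rw [← hdd]
  by_contra hneg
  push Not at hneg
  have hmax := isLocalMax_of_deriv_deriv_neg hneg hmin.deriv_eq_zero hcont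
  have hconst : f ∘ γ =ᶠ[𝓝 0] fun _ => (f ∘ γ) 0 :=
    (hmin.and hmax).mono fun t ht => le_antisymm ht.2 ht.1
  have h4 : deriv (deriv (f ∘ γ)) 0 = 0 := by
    rw [hconst.deriv.deriv_eq]
    simp
  exact hneg.ne h4

lemma symHess_add_const {f : EucSp n → ℝ} {x : EucSp n} (hf : ContDiffAt ℝ 2 f x) (c : ℝ) :
    symHess (fun y => f y + c) x = symHess f x := by
  rw [symHess, symHess, hessMatrix_add hf contDiffAt_const, hessMatrix_const, add_zero]

lemma symHess_const_mul {f : EucSp n → ℝ} {x : EucSp n} (hf : ContDiffAt ℝ 2 f x) (c : ℝ) :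
    symHess (fun y => c * f y) x = c • symHess f x := by
  rw [symHess, symHess, hessMatrix_const_mul hf, map_smul]

lemma symHess_neg {f : EucSp n → ℝ} {x : EucSp n} (hf : ContDiffAt ℝ 2 f x) :
    symHess (fun y => -f y) x = -symHess f x := by
  simpa using symHess_const_mul hf (-1)

lemma symHess_add_mul_norm_sub_sq {f : EucSp n → ℝ} {x : EucSp n} (hf : ContDiffAt ℝ 2 f x)
    (δ : ℝ) (c : EucSp n) :
    symHess (fun y => f y + δ * ‖y - c‖ ^ 2) x = symHess f x + (2 * δ) • (1 : SymMat n) := by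
  have h2 := (contDiff_norm_sub_sq c (m := 2)).contDiffAt (x := x)
  have h1 : selfAdjointPart ℝ (1 : Matrix (Fin n) (Fin n) ℝ) = 1 :=
    (IsSelfAdjoint.one _).selfAdjointPart_apply ℝ
  rw [symHess, symHess, hessMatrix_add hf (contDiffAt_const.mul h2), hessMatrix_const_mul h2,
    hessMatrix_norm_sub_sq, map_add, map_smul, map_smul, h1, smul_smul, mul_comm δ]

instance : ContinuousSMul ℝ (SymMat n) where
  continuous_smul := by
    refine Continuous.subtype_mk
      (f := fun z : ℝ × SymMat n => z.1 • (z.2 : Matrix (Fin n) (Fin n) ℝ)) ?_ _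
    exact continuous_fst.smul (continuous_subtype_val.comp continuous_snd)

lemma exists_symHess_perturb_mem {f : EucSp n → ℝ} {x : EucSp n} (hf : ContDiffAt ℝ 2 f x)
    {O : Set (SymMat n)} (hO : IsOpen O) (hx : symHess f x ∈ O) :
    ∃ ε > 0, ∀ δ : ℝ, |δ| ≤ ε → ∀ y ∈ Metric.closedBall x ε, ContDiffAt ℝ 2 f y ∧
      symHess (fun z => f z + δ * ‖z - x‖ ^ 2) y ∈ O := by
  have h1 : ∀ᶠ z : ℝ × EucSp n in 𝓝 (0, x), symHess f z.2 + (2 * z.1) • (1 : SymMat n) ∈ O := by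
    have hc : ContinuousAt (fun z : ℝ × EucSp n => symHess f z.2 + (2 * z.1) • (1 : SymMat n))
        (0, x) :=
      ((continuousAt_symHess hf).comp (x := ((0 : ℝ), x)) continuousAt_snd).add
        ((continuousAt_const.mul continuousAt_fst).smul continuousAt_const)
    exact hc.eventually (hO.mem_nhds (by simpa using hx))
  have h2 : ∀ᶠ z : ℝ × EucSp n in 𝓝 (0, x), ContDiffAt ℝ 2 f z.2 :=
    continuousAt_snd.eventually (hf.eventually (by simp))
  obtain ⟨ε, hε, h⟩ := Metric.eventually_nhds_iff_ball.1 (h1.and h2)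
  refine ⟨ε / 2, by positivity, fun δ hδ y hy => ?_⟩
  have hz : (δ, y) ∈ Metric.ball ((0 : ℝ), x) ε := by
    rw [Metric.mem_ball, Prod.dist_eq, max_lt_iff]
    rw [Metric.mem_closedBall] at hy
    simp only [Real.dist_eq, sub_zero]
    constructor <;> linarith
  obtain ⟨h3, h4⟩ := h _ hz
  refine ⟨h4, ?_⟩
  rw [symHess_add_mul_norm_sub_sq h4]
  exact h3

/-! ### Pointwise viscosity subsolutions -/

/-- The viscosity subsolution condition at a single interior point. -/
def SubAt (S : Set (SymMat n)) (u : EucSp n → EReal) (x : EucSp n) : Prop :=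
  ∀ ψ : EucSp n → ℝ, ContDiffAt ℝ 2 ψ x → (∀ᶠ y in 𝓝 x, u y ≤ (ψ y : EReal)) →
    u x = (ψ x : EReal) → symHess ψ x ∈ S

lemma fSubharmonicOn_iff {S : Set (SymMat n)} {X : Set (EucSp n)} (hX : IsOpen X)
    {u : EucSp n → EReal} : FSubharmonicOn S X u ↔
      UpperSemicontinuousOn u X ∧ (∀ x ∈ X, u x ≠ ⊤) ∧ ∀ x ∈ X, SubAt S u x := by
  refine and_congr_right fun _ => and_congr_right fun _ => forall₂_congr fun x hx => ?_
  refine forall_congr' fun ψ => ?_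
  simp only [IsTestAt, hX.nhdsWithin_eq hx, and_imp]
  refine forall_congr' fun hψ => ?_
  rw [hessMatrix_mem_image_iff hψ]

lemma SubAt.of_le {S : Set (SymMat n)} {u v : EucSp n → EReal} {x : EucSp n} (h : SubAt S u x)
    (hle : ∀ᶠ y in 𝓝 x, u y ≤ v y) (heq : v x = u x) : SubAt S v x :=
  fun ψ hψ h1 h2 => h ψ hψ ((hle.and h1).mono fun _ hy => hy.1.trans hy.2) (heq ▸ h2)

lemma subAt_coe {S : Set (SymMat n)}
    (hS : ∀ A ∈ S, ∀ P : SymMat n, (P : Matrix (Fin n) (Fin n) ℝ).PosSemidef → A + P ∈ S)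
    {q : EucSp n → ℝ} {x : EucSp n} (hq : ContDiffAt ℝ 2 q x) (hqS : symHess q x ∈ S) :
    SubAt S (fun y => (q y : EReal)) x := by
  intro ψ hψ hle heq
  simp only [EReal.coe_le_coe_iff, EReal.coe_eq_coe_iff] at hle heq
  have hmin : IsLocalMin (fun y => ψ y + -1 * q y) x := by
    filter_upwards [hle] with y hy
    linarith
  have hq' : ContDiffAt ℝ 2 (fun y => -1 * q y) x := contDiffAt_const.mul hq
  have hP := hmin.posSemidef_hessMatrix (hψ.add hq')
  have h := hS _ hqS (symHess (fun y => ψ y + -1 * q y) x) (by rwa [coe_symHess (hψ.add hq')])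
  convert h using 1
  rw [symHess, symHess, symHess, hessMatrix_add hψ hq', hessMatrix_const_mul hq]
  simp

lemma SubAt.comp_add_sub {S : Set (SymMat n)} {u : EucSp n → EReal} {x h : EucSp n}
    (hu : SubAt S u (x + h)) (c : ℝ) : SubAt S (fun y => u (y + h) - (c : EReal)) x := by
  intro ψ hψ hle heq
  have key : ∀ (a : EReal) (b : ℝ), a - (c : EReal) ≤ b ↔ a ≤ ((b + c : ℝ) : EReal) := by
    intro a b
    rw [EReal.sub_le_iff_le_add (by simp) (by simp), EReal.coe_add]
  have hT : Tendsto (fun z => z + -h) (𝓝 (x + h)) (𝓝 x) := by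
    have := (continuous_add_const (-h)).tendsto (x + h)
    simpa using this
  have hψ' : ContDiffAt ℝ 2 ψ (x + h + -h) := by simpa using hψ
  have hψ1 : ContDiffAt ℝ 2 (fun z => ψ (z + -h)) (x + h) :=
    hψ'.comp (x + h) (contDiffAt_id.add contDiffAt_const)
  have := hu (fun z => ψ (z + -h) + c) (hψ1.add contDiffAt_const) ?_ ?_
  · rw [symHess_add_const hψ1, symHess, hessMatrix_comp_add] at this
    simpa [symHess] using this
  · filter_upwards [hT.eventually hle] with z hz
    rw [key] at hz
    simpa using hz
  · refine le_antisymm ?_ ?_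
    · have := (key _ _).1 heq.le
      simpa using this
    · simp only [add_neg_cancel_right]
      rw [EReal.coe_add, ← heq, EReal.sub_add_cancel]

/-- A subsolution stays below a `C²` function whose Hessian avoids `S` if it does so on the
boundary. -/
lemma le_of_symHess_notMem {S : Set (SymMat n)} {X : Set (EucSp n)} (hX : IsOpen X)
    (hXb : Bornology.IsBounded X) {u : EucSp n → EReal}
    (hu : UpperSemicontinuousOn u (closure X)) (hut : ∀ x ∈ closure X, u x ≠ ⊤)
    (hus : ∀ x ∈ X, SubAt S u x) {w : EucSp n → ℝ} (hwc : ContinuousOn w (closure X))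
    (hw : ∀ x ∈ X, ContDiffAt ℝ 2 w x ∧ symHess w x ∉ S)
    (hbd : ∀ x ∈ frontier X, u x ≤ (w x : EReal)) : ∀ x ∈ closure X, u x ≤ (w x : EReal) := by
  by_contra! hcon
  obtain ⟨x, hx, hlt⟩ := hcon
  have husc : UpperSemicontinuousOn (fun z => u z + ((-w z : ℝ) : EReal)) (closure X) := by
    refine hu.add' ?_ fun z _ => EReal.continuousAt_add (by simp) (by simp)
    exact (continuous_coe_real_ereal.comp_continuousOn hwc.neg).upperSemicontinuousOn
  obtain ⟨x₀, hx₀, hmax⟩ := husc.exists_isMaxOn ⟨x, hx⟩ hXb.isCompact_closure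
  have hgt : (w x₀ : EReal) < u x₀ := by
    have h1 : u x + ((-w x : ℝ) : EReal) ≤ u x₀ + ((-w x₀ : ℝ) : EReal) := hmax hx
    have hx1 := hut x hx
    have hx2 := hut x₀ hx₀
    induction h : u x with
    | bot => simp [h] at hlt
    | top => exact absurd h hx1
    | coe a =>
      induction h' : u x₀ with
      | bot => rw [h, h', EReal.bot_add, ← EReal.coe_add] at h1; simp at h1
      | top => simp
      | coe b =>
        rw [h, h'] at h1
        rw [h] at hlt
        norm_cast at h1 hlt ⊢
        linarith
  have hx₀X : x₀ ∈ X := by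
    by_contra hn
    exact absurd (hbd x₀ (hX.frontier_eq ▸ ⟨hx₀, hn⟩)) (not_le.2 hgt)
  obtain ⟨m, hm⟩ : ∃ m : ℝ, u x₀ = m :=
    ⟨_, (EReal.coe_toReal (hut x₀ hx₀) (ne_bot_of_gt hgt)).symm⟩
  refine (hw x₀ hx₀X).2 ?_
  rw [← symHess_add_const (hw x₀ hx₀X).1 (m - w x₀)]
  refine hus x₀ hx₀X _ ((hw x₀ hx₀X).1.add contDiffAt_const) ?_ (by simp [hm])
  filter_upwards [hX.mem_nhds hx₀X] with z hz
  have h1 : u z + ((-w z : ℝ) : EReal) ≤ u x₀ + ((-w x₀ : ℝ) : EReal) := hmax (subset_closure hz)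
  have hz1 := hut z (subset_closure hz)
  induction h : u z with
  | bot => simp
  | top => exact absurd h hz1
  | coe a =>
    rw [h, hm] at h1
    norm_cast at h1 ⊢
    linarith

/-! ### Semicontinuity -/

lemma upperSemicontinuous_limsup_nhds {α : Type*} [TopologicalSpace α] (f : α → EReal) :
    UpperSemicontinuous fun y => limsup f (𝓝 y) := by
  intro x a ha
  obtain ⟨b, hb, hba⟩ := exists_between ha
  have h := eventually_lt_of_limsup_lt hb
  filter_upwards [eventually_eventually_nhds.2 h] with y hy
  exact (limsup_le_of_le (by isBoundedDefault) (hy.mono fun _ hz => hz.le)).trans_lt hba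

lemma le_limsup_nhds {α : Type*} [TopologicalSpace α] (f : α → EReal) (x : α) :
    f x ≤ limsup f (𝓝 x) := by
  refine le_limsup_of_le (by isBoundedDefault) fun b hb => hb.self_of_nhds

lemma upperSemicontinuous_ite_bot {α : Type*} [TopologicalSpace α] {K : Set α} (hK : IsClosed K)
    {u : α → EReal} (hu : UpperSemicontinuousOn u K) :
    UpperSemicontinuous fun y => if y ∈ K then u y else ⊥ := by
  intro x a ha
  by_cases hx : x ∈ K
  · simp only [hx, if_true] at ha
    have := hu x hx a ha
    rw [eventually_nhdsWithin_iff] at this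
    filter_upwards [this] with y hy
    split_ifs with h
    · exact hy h
    · exact bot_lt_of_lt ha
  · filter_upwards [hK.isOpen_compl.mem_nhds hx] with y hy
    rw [if_neg hy]
    exact bot_lt_of_lt ha

/-! ### The Perron family -/

/-- The Perron family on `X` with boundary data `g`. -/
def perronFamily (S : Set (SymMat n)) (X : Set (EucSp n)) (g : EucSp n → ℝ) :
    Set (EucSp n → EReal) :=
  {u | UpperSemicontinuousOn u (closure X) ∧ (∀ z ∈ closure X, u z ≠ ⊤) ∧
    (∀ x ∈ X, SubAt S u x) ∧ ∀ z ∈ frontier X, u z ≤ (g z : EReal)}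

/-- The Perron function on `closure X`, extended by `⊥`. -/
def perronSup (S : Set (SymMat n)) (X : Set (EucSp n)) (g : EucSp n → ℝ) (y : EucSp n) : EReal :=
  if y ∈ closure X then ⨆ u ∈ perronFamily S X g, u y else ⊥

/-- `w` is a `C²` function lying above `g` on `frontier X` with Hessian outside of `S` in `X`. -/
def IsUpperBarrier (S : Set (SymMat n)) (X : Set (EucSp n)) (g w : EucSp n → ℝ) : Prop :=
  ContDiff ℝ 2 w ∧ (∀ x ∈ X, symHess w x ∉ S) ∧ ∀ z ∈ frontier X, g z ≤ w z

section Perron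

variable {S : Set (SymMat n)} {X : Set (EucSp n)} {g : EucSp n → ℝ}

lemma le_perronSup {u : EucSp n → EReal} (hu : u ∈ perronFamily S X g) {y : EucSp n}
    (hy : y ∈ closure X) : u y ≤ perronSup S X g y := by
  rw [perronSup, if_pos hy]
  exact le_iSup₂ (f := fun u (_ : u ∈ perronFamily S X g) => u y) u hu

lemma perronSup_le_of_forall {y : EucSp n} {a : EReal}
    (h : y ∈ closure X → ∀ u ∈ perronFamily S X g, u y ≤ a) : perronSup S X g y ≤ a := by
  rw [perronSup]
  split_ifs with hy
  · exact iSup₂_le (h hy)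
  · exact bot_le

lemma perronSup_le_barrier (hX : IsOpen X) (hXb : Bornology.IsBounded X) {w : EucSp n → ℝ}
    (hw : IsUpperBarrier S X g w) (y : EucSp n) : perronSup S X g y ≤ (w y : EReal) :=
  perronSup_le_of_forall fun hy _ hu =>
    le_of_symHess_notMem hX hXb hu.1 hu.2.1 hu.2.2.1 hw.1.continuous.continuousOn
      (fun x hx => ⟨hw.1.contDiffAt, hw.2.1 x hx⟩)
      (fun x hx => (hu.2.2.2 x hx).trans (EReal.coe_le_coe_iff.2 (hw.2.2 x hx))) y hy

lemma sup_mem_perronFamily {u q : EucSp n → EReal} (hu : u ∈ perronFamily S X g)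
    (hq : UpperSemicontinuousOn q (closure X)) (hqt : ∀ z ∈ closure X, q z ≠ ⊤)
    (hqs : ∀ x ∈ X, u x < q x → SubAt S q x) (hqb : ∀ z ∈ frontier X, q z ≤ (g z : EReal)) :
    (fun x => max (u x) (q x)) ∈ perronFamily S X g := by
  refine ⟨hu.1.sup hq, fun z hz h => ?_, fun x hx => ?_, fun z hz =>
    max_le (hu.2.2.2 z hz) (hqb z hz)⟩
  · rcases max_choice (u z) (q z) with h' | h'
    · exact hu.2.1 z hz (h'.symm.trans h)
    · exact hqt z hz (h'.symm.trans h)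
  · rcases le_or_gt (q x) (u x) with h | h
    · exact (hu.2.2.1 x hx).of_le (Eventually.of_forall fun y => le_max_left _ _) (max_eq_left h)
    · exact (hqs x hx h).of_le (Eventually.of_forall fun y => le_max_right _ _)
        (max_eq_right h.le)

lemma sup_bump_mem_perronFamily
    (hS : ∀ A ∈ S, ∀ P : SymMat n, (P : Matrix (Fin n) (Fin n) ℝ).PosSemidef → A + P ∈ S)
    {u : EucSp n → EReal} (hu : u ∈ perronFamily S X g) {q : EucSp n → ℝ} {c : EucSp n} {s : ℝ}
    (hq : ∀ x ∈ Metric.closedBall c s, ContDiffAt ℝ 2 q x ∧ symHess q x ∈ S)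
    (hqu : ∀ x ∈ closure X, dist x c = s → (q x : EReal) ≤ u x)
    (hqb : ∀ x ∈ frontier X, x ∈ Metric.closedBall c s → q x ≤ g x) :
    (fun x => max (u x) (if x ∈ Metric.closedBall c s then (q x : EReal) else ⊥)) ∈
      perronFamily S X g := by
  refine sup_mem_perronFamily hu ?_ ?_ ?_ ?_
  · refine (upperSemicontinuous_ite_bot Metric.isClosed_closedBall ?_).upperSemicontinuousOn _
    refine ContinuousOn.upperSemicontinuousOn fun x hx => ?_
    exact (continuous_coe_real_ereal.continuousAt.comp
      (hq x hx).1.continuousAt).continuousWithinAt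
  · intro z _
    split_ifs <;> simp
  · intro x hx hlt
    split_ifs at hlt with h
    · have hd : dist x c < s :=
        lt_of_le_of_ne h fun he => not_le.2 hlt (hqu x (subset_closure hx) he)
      refine (subAt_coe hS (hq x h).1 (hq x h).2).of_le ?_ (if_pos h)
      filter_upwards [Metric.isOpen_ball.mem_nhds (Metric.mem_ball.2 hd)] with y hy
      rw [if_pos (Metric.ball_subset_closedBall hy)]
    · exact absurd hlt not_lt_bot
  · intro z hz
    split_ifs with h
    · exact EReal.coe_le_coe_iff.2 (hqb z hz h)
    · exact bot_le

/-- The Perron function belongs to the Perron family. -/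
lemma perronSup_mem (hSc : IsClosed S) (hX : IsOpen X) (hXb : Bornology.IsBounded X)
    (hne : (frontier X).Nonempty)
    (hup : ∀ y ∈ frontier X, ∀ ε > 0, ∃ w, IsUpperBarrier S X g w ∧ w y ≤ g y + ε) :
    UpperSemicontinuous (perronSup S X g) ∧ perronSup S X g ∈ perronFamily S X g := by
  set U := perronSup S X g with hU
  set V : EucSp n → EReal := fun y => limsup U (𝓝 y) with hV
  have hVw : ∀ w, IsUpperBarrier S X g w → ∀ y, V y ≤ w y := by
    intro w hw y
    have h1 : Tendsto (fun z => (w z : EReal)) (𝓝 y) (𝓝 (w y)) :=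
      (continuous_coe_real_ereal.comp hw.1.continuous).tendsto y
    rw [← h1.limsup_eq]
    exact limsup_le_limsup (Eventually.of_forall fun z => perronSup_le_barrier hX hXb hw z)
  have hUV : ∀ y, U y ≤ V y := le_limsup_nhds U
  have hVmem : V ∈ perronFamily S X g := by
    refine ⟨(upperSemicontinuous_limsup_nhds U).upperSemicontinuousOn _, ?_, ?_, ?_⟩
    · intro z _
      obtain ⟨y, hy⟩ := hne
      obtain ⟨w, hw, -⟩ := hup y hy 1 one_pos
      exact ((hVw w hw z).trans_lt (EReal.coe_lt_top _)).ne
    · intro x hx ψ hψ hle heq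
      by_contra hcon
      obtain ⟨ε, hε, h⟩ := exists_symHess_perturb_mem hψ hSc.isOpen_compl hcon
      obtain ⟨s₀, hs₀, hs₀'⟩ := Metric.eventually_nhds_iff_ball.1 (hle.and (hX.mem_nhds hx))
      set s := min ε (s₀ / 2)
      have hs : 0 < s := lt_min hε (by positivity)
      have hsub : ∀ y ∈ Metric.closedBall x s, y ∈ Metric.closedBall x ε ∧ V y ≤ ψ y ∧ y ∈ X := by
        intro y hy
        have h1 : dist y x ≤ min ε (s₀ / 2) := hy
        have h2 := h1.trans (min_le_left _ _)
        have h3 := h1.trans (min_le_right _ _)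
        exact ⟨h2, hs₀' y (Metric.mem_ball.2 (by linarith))⟩
      have hcl : closure (Metric.ball x s) ⊆ Metric.closedBall x s :=
        Metric.closure_ball_subset_closedBall
      have hCD : ∀ y ∈ Metric.closedBall x s,
          ContDiffAt ℝ 2 (fun z => ψ z + ε * ‖z - x‖ ^ 2) y := fun y hy =>
        (h ε (abs_of_pos hε).le y (hsub y hy).1).1.add
          (contDiffAt_const.mul (contDiff_norm_sub_sq x).contDiffAt)
      have hbound : ∀ y ∈ Metric.ball x s,
          U y ≤ ((ψ y + ε * ‖y - x‖ ^ 2 + -(ε * s ^ 2) : ℝ) : EReal) := by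
        intro y hy
        refine perronSup_le_of_forall fun _ u hu => ?_
        have hcl' : closure (Metric.ball x s) ⊆ closure X := fun z hz =>
          subset_closure (hsub z (hcl hz)).2.2
        refine le_of_symHess_notMem (S := S) Metric.isOpen_ball Metric.isBounded_ball
          (hu.1.mono hcl') (fun z hz => hu.2.1 z (hcl' hz))
          (fun z hz => hu.2.2.1 z (hsub z (Metric.ball_subset_closedBall hz)).2.2)
          (w := fun y => ψ y + ε * ‖y - x‖ ^ 2 + -(ε * s ^ 2)) ?_ ?_ ?_ y (subset_closure hy)
        · exact fun z hz => ((hCD z (hcl hz)).add contDiffAt_const).continuousAt.continuousWithinAt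
        · intro z hz
          have hz' := Metric.ball_subset_closedBall hz
          refine ⟨(hCD z hz').add contDiffAt_const, ?_⟩
          rw [symHess_add_const (hCD z hz')]
          exact (h ε (abs_of_pos hε).le z (hsub z hz').1).2
        · intro z hz
          have hz1 : z ∈ Metric.closedBall x s := hcl hz.1
          have hz2 : ‖z - x‖ = s := by
            rw [← dist_eq_norm]
            exact Metric.frontier_ball_subset_sphere hz
          have hz3 : u z ≤ ψ z :=
            ((le_perronSup hu (hcl' hz.1)).trans (hUV z)).trans (hsub z hz1).2.1
          simpa [hz2] using hz3
      have hlim : Tendsto (fun y => ((ψ y + ε * ‖y - x‖ ^ 2 + -(ε * s ^ 2) : ℝ) : EReal)) (𝓝 x)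
          (𝓝 ((ψ x + ε * ‖x - x‖ ^ 2 + -(ε * s ^ 2) : ℝ) : EReal)) :=
        continuous_coe_real_ereal.continuousAt.comp
          ((hCD x (Metric.mem_closedBall_self hs.le)).add contDiffAt_const).continuousAt
      have hV1 : V x ≤ ((ψ x + ε * ‖x - x‖ ^ 2 + -(ε * s ^ 2) : ℝ) : EReal) := by
        rw [← hlim.limsup_eq]
        refine limsup_le_limsup ?_
        filter_upwards [Metric.ball_mem_nhds x hs] with y hy using hbound y hy
      rw [heq, EReal.coe_le_coe_iff] at hV1
      have : 0 < ε * s ^ 2 := by positivity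
      simp at hV1
      linarith
    · intro z hz
      refine EReal.le_of_forall_lt_iff_le.1 fun a ha => ?_
      rw [EReal.coe_lt_coe_iff] at ha
      obtain ⟨w, hw, hwz⟩ := hup z hz (a - g z) (by linarith)
      exact (hVw w hw z).trans (EReal.coe_le_coe_iff.2 (by linarith))
  have hUV' : U = V := by
    funext y
    refine le_antisymm (hUV y) ?_
    by_cases hy : y ∈ closure X
    · exact le_perronSup hVmem hy
    · have h0 : U =ᶠ[𝓝 y] fun _ => ⊥ := by
        filter_upwards [isClosed_closure.isOpen_compl.mem_nhds hy] with z hz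
        exact if_neg hz
      have : V y = ⊥ := by
        simp only [hV]
        rw [limsup_congr h0]
        simp
      simp [this]
  rw [hUV']
  exact ⟨upperSemicontinuous_limsup_nhds U, hVmem⟩

end Perron

section PerronContinuity

variable {S : Set (SymMat n)} {X : Set (EucSp n)} {g : EucSp n → ℝ}

/-- If the translates of the Perron function are dominated up to `ε` at the boundary, then they
are dominated up to `ε` everywhere. -/
lemma perronSup_add_le (hXo : IsOpen X) (husc : UpperSemicontinuous (perronSup S X g))
    (hmem : perronSup S X g ∈ perronFamily S X g) {h : EucSp n} {ε : ℝ}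
    (h1 : ∀ x ∈ frontier X, x + h ∈ closure X →
      perronSup S X g (x + h) - (ε : EReal) ≤ perronSup S X g x)
    (h2 : ∀ x ∈ closure X, x + h ∈ frontier X →
      perronSup S X g (x + h) - (ε : EReal) ≤ perronSup S X g x) :
    ∀ x ∈ closure X, perronSup S X g (x + h) - (ε : EReal) ≤ perronSup S X g x := by
  set U := perronSup S X g with hU
  have hoff : ∀ x, x ∉ closure X → U x = ⊥ := fun x hx => if_neg hx
  have hq : (fun x => max (U x) (U (x + h) - (ε : EReal))) ∈ perronFamily S X g := by
    refine sup_mem_perronFamily hmem ?_ ?_ ?_ ?_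
    · have hc : UpperSemicontinuous fun x => U (x + h) + ((-ε : ℝ) : EReal) := by
        refine UpperSemicontinuous.add' ?_ upperSemicontinuous_const
          fun z => EReal.continuousAt_add (by simp) (by simp)
        exact fun x a ha => (continuous_add_const h).continuousAt.eventually (husc (x + h) a ha)
      exact hc.upperSemicontinuousOn _
    · intro z _ htop
      by_cases hz : z + h ∈ closure X
      · have h3 : U (z + h) < ⊤ := lt_top_iff_ne_top.2 (hmem.2.1 _ hz)
        have : U (z + h) - (ε : EReal) < ⊤ := by
          rw [sub_eq_add_neg]
          exact EReal.add_lt_top h3.ne (by simp [← EReal.coe_neg])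
        exact this.ne htop
      · rw [hoff _ hz] at htop
        simp at htop
    · intro x hx hlt
      by_cases hz : x + h ∈ closure X
      · have hxX : x + h ∈ X := by
          by_contra hn
          exact not_le.2 hlt (h2 x (subset_closure hx) (hXo.frontier_eq ▸ ⟨hz, hn⟩))
        exact (hmem.2.2.1 _ hxX).comp_add_sub ε
      · rw [hoff _ hz] at hlt
        simp at hlt
    · intro z hz
      by_cases hz' : z + h ∈ closure X
      · exact (h1 z hz hz').trans (hmem.2.2.2 z hz)
      · rw [hoff _ hz']
        simp
  exact fun x hx => (le_max_right _ _).trans (le_perronSup hq hx)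

/-- Perron's method with Walsh's translation argument: in the presence of barriers, the Perron
function is continuous up to the boundary, takes the prescribed boundary values, and is
harmonic. -/
theorem exists_perron_solution (hSc : IsClosed S)
    (hS : ∀ A ∈ S, ∀ P : SymMat n, (P : Matrix (Fin n) (Fin n) ℝ).PosSemidef → A + P ∈ S)
    (hX : IsOpen X) (hXb : Bornology.IsBounded X) (hne : (frontier X).Nonempty)
    (hup : ∀ y ∈ frontier X, ∀ ε > 0, ∃ w, IsUpperBarrier S X g w ∧ w y ≤ g y + ε)
    (hlow : ∀ y ∈ frontier X, ∀ ε > 0, ∃ v ∈ perronFamily S X g,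
      ∀ᶠ x in 𝓝 y, x ∈ closure X → ((g y - ε : ℝ) : EReal) ≤ v x)
    (hfin : ∃ v ∈ perronFamily S X g, ∀ x ∈ closure X, v x ≠ ⊥) :
    ∃ H : EucSp n → ℝ, ContinuousOn H (closure X) ∧
      FSubharmonicOn S X (fun y => (H y : EReal)) ∧
      FSubharmonicOn (dualSet S) X (fun y => -(H y : EReal)) ∧
      (∀ y ∈ frontier X, H y = g y) ∧
      ∀ y ∈ closure X, (H y : EReal) = ⨆ u ∈ perronFamily S X g, u y := by
  obtain ⟨husc, hmem⟩ := perronSup_mem hSc hX hXb hne hup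
  set U := perronSup S X g with hU
  set H : EucSp n → ℝ := fun y => (U y).toReal with hH
  have hUH : ∀ y ∈ closure X, U y = (H y : EReal) := by
    intro y hy
    obtain ⟨v, hv, hvb⟩ := hfin
    refine (EReal.coe_toReal (hmem.2.1 y hy) ?_).symm
    exact ((bot_lt_iff_ne_bot.2 (hvb y hy)).trans_le (le_perronSup hv hy)).ne'
  have hnear : ∀ y ∈ frontier X, ∀ ε > 0, ∀ᶠ x in 𝓝 y, x ∈ closure X →
      g y - ε ≤ H x ∧ H x ≤ g y + ε := by
    intro y hy ε hε
    obtain ⟨w, hw, hwy⟩ := hup y hy (ε / 2) (by positivity)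
    obtain ⟨v, hv, hvy⟩ := hlow y hy ε hε
    have hwc : ∀ᶠ x in 𝓝 y, w x < g y + ε :=
      hw.1.continuous.continuousAt.eventually_lt continuousAt_const (by linarith)
    filter_upwards [hvy, hwc] with x h1 h2 hx
    constructor
    · rw [← EReal.coe_le_coe_iff, ← hUH x hx]
      exact (h1 hx).trans (le_perronSup hv hx)
    · have := perronSup_le_barrier hX hXb hw x
      rw [← hU, hUH x hx, EReal.coe_le_coe_iff] at this
      linarith
  have hfc : frontier X ⊆ closure X := frontier_subset_closure
  have hbdv : ∀ y ∈ frontier X, H y = g y := by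
    intro y hy
    refine le_antisymm (le_of_forall_pos_le_add fun ε hε => ?_)
      (le_of_forall_pos_le_add fun ε hε => ?_)
    · exact ((hnear y hy ε hε).self_of_nhds (hfc hy)).2
    · linarith [((hnear y hy ε hε).self_of_nhds (hfc hy)).1]
  have hpair : ∀ y ∈ frontier X, ∀ ε > 0, ∀ᶠ z : EucSp n × EucSp n in 𝓝 (y, y),
      z.1 ∈ closure X → z.2 ∈ closure X → H z.1 - ε ≤ H z.2 := by
    intro y hy ε hε
    have h := hnear y hy (ε / 2) (by positivity)
    filter_upwards [(continuousAt_fst (p := (y, y))).eventually h,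
      (continuousAt_snd (p := (y, y))).eventually h] with z h1 h2 h3 h4
    linarith [(h1 h3).2, (h2 h4).1]
  have hcpt : IsCompact (frontier X) := hXb.isCompact_closure.of_isClosed_subset isClosed_frontier hfc
  have htrans : ∀ ε > 0, ∀ᶠ h : EucSp n in 𝓝 0, ∀ x ∈ closure X, x + h ∈ closure X →
      H (x + h) - ε ≤ H x := by
    intro ε hε
    have e1 : ∀ᶠ h : EucSp n in 𝓝 0, ∀ x ∈ frontier X, x + h ∈ closure X → x ∈ closure X →
        H (x + h) - ε ≤ H x := by
      refine hcpt.eventually_forall_of_forall_eventually fun y hy => ?_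
      have hc : ContinuousAt (fun z : EucSp n × EucSp n => (z.2 + z.1, z.2)) (0, y) := by fun_prop
      refine hc.eventually (p := fun z => z.1 ∈ closure X → z.2 ∈ closure X → H z.1 - ε ≤ H z.2) ?_
      simpa only [add_zero, sub_zero] using hpair y hy ε hε
    have e2 : ∀ᶠ h : EucSp n in 𝓝 0, ∀ x ∈ frontier X, x ∈ closure X → x - h ∈ closure X →
        H x - ε ≤ H (x - h) := by
      refine hcpt.eventually_forall_of_forall_eventually fun y hy => ?_
      have hc : ContinuousAt (fun z : EucSp n × EucSp n => (z.2, z.2 - z.1)) (0, y) := by fun_prop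
      refine hc.eventually (p := fun z => z.1 ∈ closure X → z.2 ∈ closure X → H z.1 - ε ≤ H z.2) ?_
      simpa only [add_zero, sub_zero] using hpair y hy ε hε
    filter_upwards [e1, e2] with h h1 h2 x hx hxh
    have key : ∀ a ∈ closure X, ∀ b ∈ closure X, (U a - (ε : EReal) ≤ U b ↔ H a - ε ≤ H b) := by
      intro a ha b hb
      rw [hUH a ha, hUH b hb, ← EReal.coe_sub, EReal.coe_le_coe_iff]
    rw [← key _ hxh _ hx]
    refine perronSup_add_le hX husc hmem ?_ ?_ x hx
    · intro z hz hzh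
      rw [← hU, key _ hzh _ (hfc hz)]
      exact h1 z hz hzh (hfc hz)
    · intro z hz hzh
      rw [← hU, key _ (hfc hzh) _ hz]
      simpa using h2 (z + h) hzh (hfc hzh) (by simpa using hz)
  have hcont : ContinuousOn H (closure X) := by
    intro x hx
    rw [Metric.continuousWithinAt_iff]
    intro ε hε
    obtain ⟨δ, hδ, h⟩ := Metric.eventually_nhds_iff_ball.1 (htrans (ε / 2) (by positivity))
    refine ⟨δ, hδ, fun {y} hy hyx => ?_⟩
    have h1 := h (y - x) (by simpa [dist_eq_norm] using hyx) x hx (by simpa using hy)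
    have h2 := h (x - y) (by simpa [dist_eq_norm, norm_sub_rev] using hyx) y hy (by simpa using hx)
    simp only [add_sub_cancel] at h1 h2
    rw [Real.dist_eq, abs_lt]
    constructor <;> linarith
  have hXc : ∀ x ∈ X, ContinuousAt H x := fun x hx =>
    (hcont.mono subset_closure).continuousAt (hX.mem_nhds hx)
  refine ⟨H, hcont, (fSubharmonicOn_iff hX).2 ⟨?_, by simp, ?_⟩,
    (fSubharmonicOn_iff hX).2 ⟨?_, by simp [← EReal.coe_neg], ?_⟩, hbdv, fun y hy => ?_⟩
  · exact (continuous_coe_real_ereal.comp_continuousOn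
      (hcont.mono subset_closure)).upperSemicontinuousOn
  · intro x hx
    refine (hmem.2.2.1 x hx).of_le ?_ (hUH x (subset_closure hx)).symm
    filter_upwards [hX.mem_nhds hx] with y hy using (hUH y (subset_closure hy)).le
  · simp only [← EReal.coe_neg]
    exact (continuous_coe_real_ereal.comp_continuousOn
      (hcont.mono subset_closure).neg).upperSemicontinuousOn
  · intro x hx ψ hψ hle heq hint
    simp only [← EReal.coe_neg, EReal.coe_le_coe_iff, EReal.coe_eq_coe_iff] at hle heq
    rw [← symHess_neg hψ] at hint
    obtain ⟨ε, hε, h⟩ := exists_symHess_perturb_mem hψ.neg isOpen_interior hint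
    obtain ⟨s₀, hs₀, hs₀'⟩ := Metric.eventually_nhds_iff_ball.1 (hle.and (hX.mem_nhds hx))
    set s := min ε (s₀ / 2)
    have hs : 0 < s := lt_min hε (by positivity)
    have hsub : ∀ y ∈ Metric.closedBall x s,
        y ∈ Metric.closedBall x ε ∧ -H y ≤ ψ y ∧ y ∈ X := by
      intro y hy
      have h1 : dist y x ≤ min ε (s₀ / 2) := hy
      have h2 := h1.trans (min_le_left _ _)
      have h3 := h1.trans (min_le_right _ _)
      exact ⟨h2, hs₀' y (Metric.mem_ball.2 (by linarith))⟩
    have hq := sup_bump_mem_perronFamily hS hmem (c := x) (s := s)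
      (q := fun z => -ψ z + -ε * ‖z - x‖ ^ 2 + ε * s ^ 2 / 2) ?_ ?_ ?_
    · have h1 := (le_max_right _ _).trans (le_perronSup hq (subset_closure hx))
      rw [if_pos (Metric.mem_closedBall_self hs.le), ← hU, hUH x (subset_closure hx),
        EReal.coe_le_coe_iff] at h1
      have : 0 < ε * s ^ 2 := by positivity
      simp at h1
      linarith
    · intro y hy
      obtain ⟨h1, h2⟩ := h (-ε) (by simp [abs_of_pos hε]) y (hsub y hy).1
      have h3 : ContDiffAt ℝ 2 (fun z => -ψ z + -ε * ‖z - x‖ ^ 2) y :=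
        h1.add (contDiffAt_const.mul (contDiff_norm_sub_sq x).contDiffAt)
      refine ⟨h3.add contDiffAt_const, ?_⟩
      rw [symHess_add_const h3]
      exact interior_subset h2
    · intro y hy hd
      rw [hUH y hy, EReal.coe_le_coe_iff]
      have h1 := (hsub y hd.le).2.1
      rw [dist_eq_norm] at hd
      have : 0 < ε * s ^ 2 := by positivity
      simp only [hd]
      linarith
    · intro y hy hyb
      rw [hX.frontier_eq] at hy
      exact absurd (hsub y hyb).2.2 hy.2
  · rw [← hUH y hy, hU, perronSup, if_pos hy]

end PerronContinuity

/-! ### Upper barriers -/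

lemma continuous_symProj : Continuous (symProj : EucSp n → SymMat n) := by
  refine Continuous.subtype_mk (f := fun e : EucSp n => projMat e) ?_ _
  exact continuous_matrix fun i j => by
    simp only [projMat, Matrix.of_apply]
    fun_prop

lemma posSemidef_smul_one {c : ℝ} (hc : 0 ≤ c) :
    ((c • (1 : SymMat n) : SymMat n) : Matrix (Fin n) (Fin n) ℝ).PosSemidef := by
  simpa using Matrix.PosSemidef.one.smul hc

lemma CondF3.exists_uniform {F : ConeSubequation n} (h : CondF3 F) :
    ∃ κ : ℝ, 0 < κ ∧ ∀ κ' ≤ κ, ∀ e : EucSp n, ‖e‖ = 1 →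
      -(symProj e) + κ' • (1 : SymMat n) ∉ F.carrier := by
  have hP : ∀ᶠ κ : ℝ in 𝓝 0, ∀ e ∈ Metric.sphere (0 : EucSp n) 1,
      -(symProj e) + κ • (1 : SymMat n) ∉ F.carrier := by
    refine (isCompact_sphere (0 : EucSp n) 1).eventually_forall_of_forall_eventually
      (P := fun κ e => -(symProj e) + κ • (1 : SymMat n) ∉ F.carrier) fun e he => ?_
    have hc : Continuous fun z : ℝ × EucSp n => -(symProj z.2) + z.1 • (1 : SymMat n) :=
      (continuous_symProj.comp continuous_snd).neg.add (continuous_fst.smul continuous_const)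
    refine hc.continuousAt.eventually (F.isClosed'.isOpen_compl.mem_nhds ?_)
    simpa using h e (by simpa using he)
  obtain ⟨ε, hε, hball⟩ := Metric.eventually_nhds_iff_ball.1 hP
  refine ⟨ε / 2, by positivity, fun κ' hκ' e he hmem => ?_⟩
  refine hball (ε / 2) (by simp [abs_of_pos hε, hε]) e (by simpa using he) ?_
  have := F.f1 _ hmem _ (posSemidef_smul_one (sub_nonneg.2 hκ'))
  rwa [add_assoc, ← add_smul, add_sub_cancel] at this

lemma exists_mul_dominates {α : Type*} [TopologicalSpace α] {K : Set α} (hK : IsCompact K)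
    {g d : α → ℝ} (hg : ContinuousOn g K) (hd : ContinuousOn d K) {y : α}
    (hd0 : ∀ z ∈ K, 0 ≤ d z) (hdpos : ∀ z ∈ K, z ≠ y → 0 < d z) {ε : ℝ} (hε : 0 < ε) :
    ∃ C > 0, ∀ z ∈ K, g z ≤ g y + ε + C * d z := by
  by_cases hy : y ∈ K
  swap
  · have hq : ContinuousOn (fun z => (g z - g y) / d z) K :=
      (hg.sub continuousOn_const).div hd
        fun z hz => (hdpos z hz fun h => hy (h ▸ hz)).ne'
    obtain ⟨C, hC⟩ := (hK.bddAbove_image hq)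
    refine ⟨max C 1, by positivity, fun z hz => ?_⟩
    have h1 := hdpos z hz fun h => hy (h ▸ hz)
    have h2 := (div_le_iff₀ h1).1 ((hC ⟨z, hz, rfl⟩).trans (le_max_left C 1))
    linarith
  · set L := K ∩ g ⁻¹' Set.Ici (g y + ε) with hL
    have hLK : IsCompact L := by
      obtain ⟨t, ht, hteq⟩ := continuousOn_iff_isClosed.1 hg _ (isClosed_Ici (a := g y + ε))
      rw [hL, Set.inter_comm, hteq, Set.inter_comm]
      exact hK.inter_right ht
    have hne : ∀ z ∈ L, z ≠ y := by
      rintro z ⟨_, h⟩ rfl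
      simp only [Set.mem_preimage, Set.mem_Ici] at h
      linarith
    have hq : ContinuousOn (fun z => (g z - g y) / d z) L :=
      ((hg.mono Set.inter_subset_left).sub continuousOn_const).div (hd.mono Set.inter_subset_left)
        fun z hz => (hdpos z hz.1 (hne z hz)).ne'
    obtain ⟨C, hC⟩ := (hLK.bddAbove_image hq)
    refine ⟨max C 1, by positivity, fun z hz => ?_⟩
    by_cases hzL : g y + ε ≤ g z
    · have hz' : z ∈ L := ⟨hz, hzL⟩
      have h2 := (div_le_iff₀ (hdpos z hz (hne z hz'))).1
        ((hC ⟨z, hz', rfl⟩).trans (le_max_left C 1))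
      linarith
    · have := mul_nonneg (le_max_of_le_right zero_le_one : 0 ≤ max C 1) (hd0 z hz)
      linarith

lemma exists_upperBarrier {F : ConeSubequation n} (hF3 : CondF3 F) {X : Set (EucSp n)}
    (hX : Bornology.IsBounded X) {g : EucSp n → ℝ} (hg : ContinuousOn g (frontier X))
    {y c : EucSp n} (hcy : y ≠ c) (hext : ∀ x ∈ closure X, x ≠ y → ‖y - c‖ < ‖x - c‖)
    {ε : ℝ} (hε : 0 < ε) :
    ∃ w, IsUpperBarrier F.carrier X g w ∧ w y ≤ g y + ε := by
  obtain ⟨κ, hκ, hκF⟩ := hF3.exists_uniform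
  have hs : 0 < ‖y - c‖ := norm_pos_iff.2 (sub_ne_zero.2 hcy)
  set s := ‖y - c‖ with hsdef
  set α := (2 * κ * s ^ 2)⁻¹ with hα
  have hα0 : 0 < α := by positivity
  have hle : ∀ x ∈ closure X, s ≤ ‖x - c‖ := fun x hx => by
    by_cases h : x = y
    · rw [h]
    · exact (hext x hx h).le
  obtain ⟨C, hC, hdom⟩ := exists_mul_dominates (K := frontier X) (g := g)
    (d := fun x => Real.exp (-α * s ^ 2) - Real.exp (-α * ‖x - c‖ ^ 2)) (y := y)
    (Metric.isCompact_of_isClosed_isBounded isClosed_frontier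
      (hX.closure.subset frontier_subset_closure)) hg (by fun_prop)
    (fun z hz => by
      have := hle z (frontier_subset_closure hz)
      have h2 : s ^ 2 ≤ ‖z - c‖ ^ 2 := by gcongr
      rw [sub_nonneg, Real.exp_le_exp]
      nlinarith)
    (fun z hz hzy => by
      have := hext z (frontier_subset_closure hz) hzy
      have h2 : s ^ 2 < ‖z - c‖ ^ 2 := by gcongr
      rw [sub_pos, Real.exp_lt_exp]
      nlinarith) hε
  have h2 : ∀ m : WithTop ℕ∞, ContDiff ℝ m fun x : EucSp n => ‖x - c‖ ^ 2 :=
    fun m => contDiff_norm_sub_sq c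
  refine ⟨fun x => g y + ε + C * (Real.exp (-α * s ^ 2) - Real.exp (-α * ‖x - c‖ ^ 2)),
    ⟨?_, fun x hx hmem => ?_, hdom⟩, ?_⟩
  · exact contDiff_const.add (contDiff_const.mul (contDiff_const.sub
      (Real.contDiff_exp.comp (contDiff_const.mul (h2 2)))))
  · have hsx : s ≤ ‖x - c‖ := hle x (subset_closure hx)
    have hx0 : 0 < ‖x - c‖ := hs.trans_le hsx
    set e : EucSp n := ‖x - c‖⁻¹ • (x - c) with he
    have he1 : ‖e‖ = 1 := by
      rw [he, norm_smul, norm_inv, norm_norm, inv_mul_cancel₀ hx0.ne']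
    set E := Real.exp (-α * ‖x - c‖ ^ 2) with hE
    have hE0 : 0 < E := Real.exp_pos _
    set κ' := (2 * α * ‖x - c‖ ^ 2)⁻¹ with hκ'
    have hκ'le : κ' ≤ κ := by
      rw [hκ', hα]
      have h3 : s ^ 2 ≤ ‖x - c‖ ^ 2 := by gcongr
      have h4 : (2 * (2 * κ * s ^ 2)⁻¹ * ‖x - c‖ ^ 2)⁻¹ = κ * (s ^ 2 / ‖x - c‖ ^ 2) := by
        field_simp
      rw [h4]
      exact mul_le_of_le_one_right hκ.le (div_le_one_of_le₀ h3 (by positivity))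
    set m := 4 * C * α ^ 2 * E * ‖x - c‖ ^ 2 with hm
    have hm0 : 0 < m := by positivity
    have hHess : symHess (fun x => g y + ε + C * (Real.exp (-α * s ^ 2)
        - Real.exp (-α * ‖x - c‖ ^ 2))) x = m • (-(symProj e) + κ' • (1 : SymMat n)) := by
      have hcd : ContDiff ℝ 2 (fun x => g y + ε + C * (Real.exp (-α * s ^ 2)
        - Real.exp (-α * ‖x - c‖ ^ 2))) := contDiff_const.add (contDiff_const.mul
          (contDiff_const.sub (Real.contDiff_exp.comp (contDiff_const.mul (h2 2)))))
      apply Subtype.ext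
      rw [coe_symHess hcd.contDiffAt,
        hessMatrix_comp (f := fun x => ‖x - c‖ ^ 2)
        (χ := fun t => g y + ε + C * (Real.exp (-α * s ^ 2) - Real.exp (-α * t)))
        (χ' := fun t => C * α * Real.exp (-α * t)) (χ'' := - (C * α ^ 2 * E)) (h2 2).contDiffAt
        ?_ ?_, hessMatrix_norm_sub_sq, (hasFDerivAt_norm_sub_sq c x).fderiv]
      · ext i j
        have hv : ∀ v : EucSp n, ∀ k, inner ℝ v (EuclideanSpace.single k (1 : ℝ)) = v k := by
          simp [EuclideanSpace.inner_single_right]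
        have hE' : Real.exp (-(α * ‖x - c‖ ^ 2)) = E := by rw [hE, neg_mul]
        simp only [symProj, projMat, he]
        simp [hv, Matrix.one_apply, hE']
        rw [hm, hκ']
        split_ifs <;> field_simp <;> ring
      · intro t
        have := ((((hasDerivAt_id t).const_mul (-α)).exp.const_sub
          (Real.exp (-α * s ^ 2))).const_mul C).const_add (g y + ε)
        exact this.congr_deriv (by simp only [id]; ring)
      · have := (((hasDerivAt_id (‖x - c‖ ^ 2)).const_mul (-α)).exp).const_mul (C * α)
        exact this.congr_deriv (by simp only [hE, id]; ring)
    rw [hHess] at hmem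
    have := F.f2 _ hmem m⁻¹ (inv_pos.2 hm0)
    rw [inv_smul_smul₀ hm0.ne'] at this
    exact hκF κ' hκ'le e he1 this
  · simp [← hsdef]

/-! ### Exterior spheres -/

lemma exists_taylor_bound {ρ : EucSp n → ℝ} {y : EucSp n} (hρ : ContDiffAt ℝ 2 ρ y) :
    ∃ K > 0, ∃ δ > 0, ∀ x, ‖x - y‖ < δ →
      |ρ x - ρ y - fderiv ℝ ρ y (x - y)| ≤ K * ‖x - y‖ ^ 2 := by
  obtain ⟨K, t, ht, hK⟩ := (hρ.fderiv_right (m := 1) (by norm_num)).exists_lipschitzOnWith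
  have hev := (hρ.eventually (by simp)).and (eventually_mem_set.2 ht)
  obtain ⟨δ, hδ, hball⟩ := Metric.eventually_nhds_iff_ball.1 hev
  refine ⟨K + 1, by positivity, δ, hδ, fun x hx => ?_⟩
  have hsub : ∀ z ∈ Metric.closedBall y ‖x - y‖, z ∈ Metric.ball y δ := fun z hz =>
    (Metric.mem_closedBall.1 hz).trans_lt hx
  have hy : y ∈ Metric.ball y δ := Metric.mem_ball_self hδ
  have := (convex_closedBall y ‖x - y‖).norm_image_sub_le_of_norm_fderiv_le'
    (f := ρ) (φ := fderiv ℝ ρ y) (C := K * ‖x - y‖)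
    (fun z hz => (hball z (hsub z hz)).1.differentiableAt two_ne_zero) (fun z hz => ?_)
    (Metric.mem_closedBall_self (norm_nonneg _)) (y := x) (by simp [dist_eq_norm])
  · rw [Real.norm_eq_abs] at this
    nlinarith [sq_nonneg ‖x - y‖]
  · refine (hK.norm_sub_le (hball z (hsub z hz)).2 (hball y hy).2).trans ?_
    gcongr
    simpa [dist_eq_norm] using hz

lemma exists_exterior_sphere_of_gradient {ρ : EucSp n → ℝ} {y : EucSp n}
    (hρ : ContDiffAt ℝ 2 ρ y) (hy : ρ y = 0) (hN : gradient ρ y ≠ 0) :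
    ∃ c, y ≠ c ∧ ∀ x, ρ x ≤ 0 → x ≠ y → ‖y - c‖ < ‖x - c‖ := by
  obtain ⟨K, hK, δ, hδ, hT⟩ := exists_taylor_bound hρ
  set N := gradient ρ y with hNdef
  have ha : 0 < ‖N‖ := norm_pos_iff.2 hN
  obtain ⟨s, hs, hs1, hs2⟩ : ∃ s > 0, 2 * s < δ ∧ 2 * s * K < ‖N‖ := by
    refine ⟨min (δ / 4) (‖N‖ / (4 * K)), by positivity, ?_, ?_⟩
    · linarith [min_le_left (δ / 4) (‖N‖ / (4 * K))]
    · have := min_le_right (δ / 4) (‖N‖ / (4 * K))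
      rw [le_div_iff₀ (by positivity)] at this
      linarith
  set e : EucSp n := ‖N‖⁻¹ • N with he
  have he1 : ‖e‖ = 1 := by
    rw [he, norm_smul, norm_inv, norm_norm, inv_mul_cancel₀ ha.ne']
  refine ⟨y + s • e, ?_, fun x hx hxy => ?_⟩
  · intro h
    have : s • e = 0 := by simpa using h.symm
    rcases smul_eq_zero.1 this with h | h
    · exact hs.ne' h
    · simp [h] at he1
  have hv : 0 < ‖x - y‖ := norm_pos_iff.2 (sub_ne_zero.2 hxy)
  have h1 : ‖y - (y + s • e)‖ = s := by
    rw [sub_add_cancel_left, norm_neg, norm_smul, he1, Real.norm_of_nonneg hs.le, mul_one]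
  have h2 : ‖x - (y + s • e)‖ ^ 2 = ‖x - y‖ ^ 2 - 2 * s * inner ℝ (x - y) e + s ^ 2 := by
    rw [← sub_sub, norm_sub_sq_real, inner_smul_right, norm_smul, he1,
      Real.norm_of_nonneg hs.le]
    ring
  rw [h1]
  refine lt_of_pow_lt_pow_left₀ 2 (norm_nonneg _) ?_
  rw [h2]
  suffices 2 * s * inner ℝ (x - y) e < ‖x - y‖ ^ 2 by linarith
  by_cases hd : ‖x - y‖ < δ
  · have h3 := (abs_le.1 (hT x hd)).1
    have h4 : fderiv ℝ ρ y (x - y) = ‖N‖ * inner ℝ (x - y) e := by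
      rw [he, inner_smul_right, ← mul_assoc, mul_inv_cancel₀ ha.ne', one_mul,
        real_inner_comm, hNdef, gradient, InnerProductSpace.toDual_symm_apply]
    rw [hy, h4] at h3
    have h5 : ‖N‖ * inner ℝ (x - y) e ≤ K * ‖x - y‖ ^ 2 := by linarith
    have h6 : ‖N‖ * (2 * s * inner ℝ (x - y) e) < ‖N‖ * ‖x - y‖ ^ 2 := by
      calc ‖N‖ * (2 * s * inner ℝ (x - y) e) = 2 * s * (‖N‖ * inner ℝ (x - y) e) := by ring
        _ ≤ 2 * s * (K * ‖x - y‖ ^ 2) := by gcongr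
        _ = (2 * s * K) * ‖x - y‖ ^ 2 := by ring
        _ < _ := by gcongr
    exact lt_of_mul_lt_mul_left h6 ha.le
  · have h3 := real_inner_le_norm (x - y) e
    rw [he1, mul_one] at h3
    have h4 : 2 * s * inner ℝ (x - y) e ≤ 2 * s * ‖x - y‖ := by gcongr
    nlinarith

lemma exists_exterior_sphere_of_ball {p y : EucSp n} {r : ℝ} (hr : 0 < r) (hy : ‖y - p‖ = r) :
    ∃ c, y ≠ c ∧ ∀ x, r ≤ ‖x - p‖ → x ≠ y → ‖y - c‖ < ‖x - c‖ := by
  set b := y - p with hb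
  have hyc : y - (p + (2⁻¹ : ℝ) • b) = (2⁻¹ : ℝ) • b := by rw [hb]; module
  refine ⟨p + (2⁻¹ : ℝ) • b, ?_, fun x hx hxy => ?_⟩
  · intro h
    rw [← sub_eq_zero, hyc] at h
    have : b = 0 := by simpa using h
    rw [this, norm_zero] at hy
    exact hr.ne hy
  · rw [hyc]
    refine lt_of_pow_lt_pow_left₀ 2 (norm_nonneg _) ?_
    have h1 : x - (p + (2⁻¹ : ℝ) • b) = (x - p) - (2⁻¹ : ℝ) • b := by module
    have h2 : 0 < ‖(x - p) - b‖ ^ 2 := by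
      have : (x - p) - b ≠ 0 := by
        rw [hb, sub_sub_sub_cancel_right]
        exact sub_ne_zero.2 hxy
      positivity
    rw [norm_sub_sq_real, hy] at h2
    rw [h1, norm_sub_sq_real, norm_smul, inner_smul_right, hy]
    norm_num
    nlinarith

/-! ### Lower barriers at strictly convex boundary points -/

lemma ConeSubequation.add_mem_interior_s9 (F : ConeSubequation n) {A P : SymMat n}
    (hA : A ∈ interior F.carrier) (hP : (P : Matrix (Fin n) (Fin n) ℝ).PosSemidef) :
    A + P ∈ interior F.carrier := by
  have ho : IsOpen ((fun B : SymMat n => B - P) ⁻¹' interior F.carrier) :=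
    isOpen_interior.preimage (continuous_id.sub continuous_const)
  refine interior_maximal (fun B hB => ?_) ho (by simpa using hA)
  simpa using F.f1 _ (interior_subset hB) P hP

lemma ConeSubequation.smul_mem_interior (F : ConeSubequation n) {A : SymMat n}
    (hA : A ∈ interior F.carrier) {t : ℝ} (ht : 0 < t) : t • A ∈ interior F.carrier := by
  have ho : IsOpen ((fun B : SymMat n => t⁻¹ • B) ⁻¹' interior F.carrier) :=
    isOpen_interior.preimage (continuous_const_smul _)
  refine interior_maximal (fun B hB => ?_) ho (by simpa [inv_smul_smul₀ ht.ne'] using hA)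
  simpa [smul_inv_smul₀ ht.ne'] using F.f2 _ (interior_subset hB) t ht

open Matrix in
lemma projMat_mulVec (e : EucSp n) (v : Fin n → ℝ) :
    projMat e *ᵥ v = (⇑e ⬝ᵥ v) • ⇑e := by
  ext i
  simp only [projMat, Matrix.mulVec, dotProduct, Matrix.of_apply, Pi.smul_apply, smul_eq_mul,
    Finset.sum_mul]
  exact Finset.sum_congr rfl fun j _ => by ring

open Matrix in
lemma ConeSubequation.exists_mem_interior_of_tangential (F : ConeSubequation n) {A M : SymMat n}
    {e : EucSp n} {t₀ : ℝ} (hM : M ∈ interior F.carrier)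
    (hMA : (M : Matrix (Fin n) (Fin n) ℝ) =
      (1 - projMat e) * (A : Matrix (Fin n) (Fin n) ℝ) * (1 - projMat e) + t₀ • projMat e) :
    ∃ t : ℝ, ∃ κ : ℝ, 0 < κ ∧ A + t • symProj e - κ • (1 : SymMat n) ∈ interior F.carrier := by
  obtain ⟨κ, hκ, hMκ⟩ : ∃ κ : ℝ, 0 < κ ∧ M - κ • (1 : SymMat n) ∈ interior F.carrier := by
    have hc : Continuous fun κ : ℝ => M - κ • (1 : SymMat n) :=
      continuous_const.sub (continuous_id.smul continuous_const)
    have hev : ∀ᶠ κ : ℝ in 𝓝 0, M - κ • (1 : SymMat n) ∈ interior F.carrier :=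
      hc.continuousAt.eventually (isOpen_interior.mem_nhds (by simpa using hM))
    obtain ⟨ε, hε, hball⟩ := Metric.eventually_nhds_iff_ball.1 hev
    exact ⟨ε / 2, by positivity, hball _ (by simp [abs_of_pos hε, hε])⟩
  set a : Matrix (Fin n) (Fin n) ℝ := (A : Matrix (Fin n) (Fin n) ℝ) with ha
  set p : Fin n → ℝ := ⇑e with hp
  set k : Fin n → ℝ := a *ᵥ p with hk
  have hasymm : aᵀ = a := by
    have := selfAdjoint.mem_iff.1 A.2
    rwa [star_eq_conjTranspose, conjTranspose_eq_transpose_of_trivial] at this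
  set t := t₀ + (p ⬝ᵥ k + 2 / κ * (k ⬝ᵥ k)) with ht
  refine ⟨t, κ / 2, by positivity, ?_⟩
  set D : SymMat n := (A + t • symProj e - (κ / 2) • (1 : SymMat n)) - (M - κ • (1 : SymMat n))
    with hD
  have hDP : (D : Matrix (Fin n) (Fin n) ℝ).PosSemidef := by
    refine PosSemidef.of_dotProduct_mulVec_nonneg (selfAdjoint.mem_iff.1 D.2) fun v => ?_
    have hD' : (D : Matrix (Fin n) (Fin n) ℝ) = a + t • projMat e - (κ / 2) • 1 -
        ((1 - projMat e) * a * (1 - projMat e) + t₀ • projMat e - κ • 1) := by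
      rw [hD, ← hMA]
      rfl
    have hsym : p ⬝ᵥ (a *ᵥ v) = v ⬝ᵥ k := by
      rw [hk, dotProduct_mulVec, ← mulVec_transpose, hasymm, dotProduct_comm]
    set m := p ⬝ᵥ v with hm
    have hvp : v ⬝ᵥ p = m := dotProduct_comm _ _
    have hsq : 0 ≤ (v + (2 * m / κ) • k) ⬝ᵥ (v + (2 * m / κ) • k) := by
      simpa using dotProduct_star_self_nonneg (v + (2 * m / κ) • k)
    have hkv : k ⬝ᵥ v = v ⬝ᵥ k := dotProduct_comm _ _
    simp only [add_dotProduct, dotProduct_add, smul_dotProduct, dotProduct_smul, smul_eq_mul,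
      hkv] at hsq
    have key : star v ⬝ᵥ ((D : Matrix (Fin n) (Fin n) ℝ) *ᵥ v) = κ / 2 *
        (v ⬝ᵥ v + 2 * m / κ * (v ⬝ᵥ k) + 2 * m / κ * (v ⬝ᵥ k + 2 * m / κ * (k ⬝ᵥ k))) := by
      rw [hD', star_trivial]
      simp only [sub_mulVec, add_mulVec, smul_mulVec, one_mulVec, ← mulVec_mulVec,
        projMat_mulVec, mulVec_sub, mulVec_smul, dotProduct_sub, dotProduct_add, dotProduct_smul,
        smul_eq_mul, ← hp, ← hk, ← hm, hsym, hvp]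
      rw [ht]
      field_simp
      ring
    rw [key]
    have : 0 ≤ κ / 2 := by positivity
    refine mul_nonneg this (hsq.trans_eq ?_)
    ring
  have := F.add_mem_interior_s9 hMκ hDP
  rwa [hD, add_sub_cancel] at this

lemma exists_lowerBarrier (F : ConeSubequation n) {ρ : EucSp n → ℝ} (hρ : ContDiff ℝ 2 ρ)
    {y : EucSp n} (hy : ρ y = 0) (hN : gradient ρ y ≠ 0) {t₀ : ℝ}
    (h : secondFF ρ y + t₀ • projMat (innerNormal ρ y) ∈ Subtype.val '' interior F.carrier) :
    ∃ b : EucSp n → ℝ, ContDiff ℝ 2 b ∧ symHess b y ∈ interior F.carrier ∧ b y = 0 ∧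
      ∃ η > 0, ∀ᶠ x in 𝓝 y, ρ x ≤ 0 → b x ≤ -(η * ‖x - y‖ ^ 2) := by
  obtain ⟨M, hM, hMeq⟩ := h
  set a := ‖gradient ρ y‖ with ha
  have ha0 : 0 < a := norm_pos_iff.2 hN
  set e := innerNormal ρ y with he
  obtain ⟨t, κ, hκ, hmem⟩ := F.exists_mem_interior_of_tangential (A := a⁻¹ • symHess ρ y) (e := e)
    (t₀ := t₀) hM (by
    rw [hMeq, secondFF]
    simp [coe_symHess hρ.contDiffAt, ← ha, ← he])
  have hmem' := F.smul_mem_interior hmem ha0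
  set T := t / a with hT
  have hgrad : ∀ i, fderiv ℝ ρ y (EuclideanSpace.single i 1) = -(a * e i) := fun i => by
    have h1 : fderiv ℝ ρ y (EuclideanSpace.single i 1) = gradient ρ y i := by
      rw [← InnerProductSpace.toDual_symm_apply (𝕜 := ℝ) (y := fderiv ℝ ρ y),
        EuclideanSpace.inner_single_right]
      simp [gradient]
    rw [h1, he, innerNormal, ← ha]
    simp [mul_inv_cancel_left₀ ha0.ne']
  have hc1 : ContDiff ℝ 2 fun x => ρ x + T / 2 * ρ x ^ 2 :=
    hρ.add (contDiff_const.mul (hρ.pow 2))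
  have hH1 : symHess (fun x => ρ x + T / 2 * ρ x ^ 2) y
      = symHess ρ y + (T * a ^ 2) • symProj e := by
    apply Subtype.ext
    rw [coe_symHess hc1.contDiffAt, hessMatrix_comp (f := ρ) (χ := fun s => s + T / 2 * s ^ 2)
      (χ' := fun s => 1 + T * s) (χ'' := T) hρ.contDiffAt]
    · ext i j
      simp [hy, hgrad, symProj, projMat, coe_symHess hρ.contDiffAt]
      ring
    · intro s
      exact ((hasDerivAt_id s).add (((hasDerivAt_id s).pow 2).const_mul (T / 2))).congr_deriv
        (by simp; ring)
    · exact (((hasDerivAt_id (ρ y)).const_mul T).const_add 1).congr_deriv (by simp)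
  refine ⟨fun x => ρ x + T / 2 * ρ x ^ 2 + -(a * κ / 2) * ‖x - y‖ ^ 2,
    hc1.add (contDiff_const.mul (contDiff_norm_sub_sq y)), ?_, by simp [hy], a * κ / 2,
    by positivity, ?_⟩
  · rw [symHess_add_mul_norm_sub_sq hc1.contDiffAt, hH1]
    convert hmem' using 1
    rw [smul_sub, smul_add, smul_smul, smul_smul, smul_smul, mul_inv_cancel₀ ha0.ne', one_smul,
      sub_eq_add_neg, ← neg_smul]
    congr 3
    · rw [hT]; field_simp
    · ring
  · have : ∀ᶠ x in 𝓝 y, 0 < 1 + T / 2 * ρ x := by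
      have hc : Continuous fun x => 1 + T / 2 * ρ x := by
        have := hρ.continuous
        fun_prop
      exact hc.continuousAt.eventually (lt_mem_nhds (by simp [hy]))
    filter_upwards [this] with x hx hρx
    nlinarith

lemma exists_mem_perronFamily_of_lowerBarrier {F : ConeSubequation n} {X : Set (EucSp n)}
    (hX : Bornology.IsBounded X) {g : EucSp n → ℝ} (hg : ContinuousOn g (frontier X))
    {u : EucSp n → EReal} (hu : u ∈ perronFamily F.carrier X g)
    (huc : ContinuousOn u (closure X)) (hubot : ∀ x ∈ closure X, u x ≠ ⊥)
    {y : EucSp n} (hy : y ∈ frontier X) {b : EucSp n → ℝ} (hb : ContDiff ℝ 2 b)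
    (hbF : symHess b y ∈ interior F.carrier) (hby : b y = 0) {η : ℝ} (hη : 0 < η)
    (hbX : ∀ᶠ x in 𝓝 y, x ∈ closure X → b x ≤ -(η * ‖x - y‖ ^ 2)) {ε : ℝ} (hε : 0 < ε) :
    ∃ v ∈ perronFamily F.carrier X g,
      ∀ᶠ x in 𝓝 y, x ∈ closure X → ((g y - ε : ℝ) : EReal) ≤ v x := by
  have hev1 : ∀ᶠ x in 𝓝 y, symHess b x ∈ interior F.carrier :=
    (continuousAt_symHess hb.contDiffAt).eventually (isOpen_interior.mem_nhds hbF)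
  have hev2 : ∀ᶠ x in 𝓝 y, x ∈ frontier X → g y - ε / 2 < g x :=
    eventually_nhdsWithin_iff.1 ((hg y hy).eventually (lt_mem_nhds (by linarith)))
  obtain ⟨s', hs', hball⟩ := Metric.eventually_nhds_iff_ball.1 (hev1.and (hev2.and hbX))
  obtain ⟨s, hs, hss⟩ : ∃ s > 0, s < s' := ⟨s' / 2, by positivity, by linarith⟩
  have hball' : ∀ x ∈ Metric.closedBall y s, symHess b x ∈ interior F.carrier ∧
      (x ∈ frontier X → g y - ε / 2 < g x) ∧ (x ∈ closure X → b x ≤ -(η * ‖x - y‖ ^ 2)) :=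
    fun x hx => hball x ((Metric.mem_closedBall.1 hx).trans_lt hss)
  obtain ⟨L, hL⟩ : ∃ L : ℝ, ∀ x ∈ closure X, (L : EReal) ≤ u x := by
    have hK : IsCompact (closure X) := Metric.isCompact_of_isClosed_isBounded isClosed_closure
      hX.closure
    obtain ⟨x₀, hx₀, hmin⟩ := hK.exists_isMinOn ⟨y, frontier_subset_closure hy⟩ huc
    refine ⟨(u x₀).toReal, fun x hx => ?_⟩
    rw [EReal.coe_toReal (hu.2.1 x₀ hx₀) (hubot x₀ hx₀)]
    exact hmin hx
  set C := max 1 ((g y - ε / 2 - L) / (η * s ^ 2)) with hC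
  have hC0 : 0 < C := by positivity
  have hCL : g y - ε / 2 - L ≤ C * (η * s ^ 2) :=
    (div_le_iff₀ (by positivity)).1 (le_max_right _ _)
  set q : EucSp n → ℝ := fun x => C * b x + (g y - ε / 2) with hq
  have hqc : ContDiff ℝ 2 q := (contDiff_const.mul hb).add contDiff_const
  refine ⟨_, sup_bump_mem_perronFamily F.f1 hu (q := q) (c := y) (s := s)
    (fun x hx => ⟨hqc.contDiffAt, ?_⟩) (fun x hx hd => ?_) (fun x hx hxs => ?_), ?_⟩
  · rw [hq, symHess_add_const (contDiff_const.mul hb).contDiffAt, symHess_const_mul hb.contDiffAt]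
    exact F.f2 _ (interior_subset (hball' x hx).1) C hC0
  · refine le_trans ?_ (hL x hx)
    have h1 := (hball' x (Metric.mem_closedBall.2 hd.le)).2.2 hx
    rw [← dist_eq_norm, hd] at h1
    have h2 := mul_le_mul_of_nonneg_left h1 hC0.le
    rw [EReal.coe_le_coe_iff, hq]
    simp only
    linarith
  · have h1 := (hball' x hxs).2.2 (frontier_subset_closure hx)
    have h2 := (hball' x hxs).2.1 hx
    have h3 : b x ≤ 0 := h1.trans (neg_nonpos.2 (by positivity))
    have h4 := mul_nonpos_of_nonneg_of_nonpos hC0.le h3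
    rw [hq]
    simp only
    linarith
  · have hev3 : ∀ᶠ x in 𝓝 y, g y - ε < q x :=
      hqc.continuous.continuousAt.eventually (lt_mem_nhds (by simp [hq, hby]; linarith))
    filter_upwards [hev3, Metric.closedBall_mem_nhds y hs] with x hx hxs _
    refine le_max_of_le_right ?_
    rw [if_pos hxs, EReal.coe_le_coe_iff]
    exact hx.le

/-! ### The perforated domain -/

lemma le_dist_of_mem_closure_diff {k : ℕ} {Ω : Set (EucSp n)} {x : Fin k → EucSp n} {r : ℝ}
    {z : EucSp n} (hz : z ∈ closure (Ω \ ⋃ j, Metric.closedBall (x j) r)) (j : Fin k) :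
    r ≤ dist z (x j) := by
  have hc : IsClosed {z : EucSp n | r ≤ dist z (x j)} :=
    isClosed_le continuous_const (continuous_id.dist continuous_const)
  refine closure_minimal (fun w hw => ?_) hc hz
  by_contra h
  exact hw.2 (Set.mem_iUnion.2 ⟨j, Metric.mem_closedBall.2 (not_le.1 h).le⟩)

lemma isClosed_iUnion_closedBall {k : ℕ} (x : Fin k → EucSp n) (r : ℝ) :
    IsClosed (⋃ j, Metric.closedBall (x j) r) :=
  isClosed_iUnion_of_finite fun _ => Metric.isClosed_closedBall

lemma frontier_diff_iUnion_closedBall {k : ℕ} {Ω : Set (EucSp n)} (hΩ : IsOpen Ω)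
    {x : Fin k → EucSp n} {r : ℝ} (hr : 0 < r)
    (hballs : ∀ j, Metric.closedBall (x j) r ⊆ Ω)
    (hdisj : ∀ j j', j ≠ j' →
      Disjoint (Metric.closedBall (x j) r) (Metric.closedBall (x j') r)) :
    frontier (Ω \ ⋃ j, Metric.closedBall (x j) r) =
      frontier Ω ∪ ⋃ j, Metric.sphere (x j) r := by
  have hB := isClosed_iUnion_closedBall x r
  rw [(hΩ.sdiff hB).frontier_eq, hΩ.frontier_eq]
  ext z
  constructor
  · rintro ⟨hz, hzX⟩
    by_cases hzΩ : z ∈ Ω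
    · right
      obtain ⟨j, hj⟩ : ∃ j, z ∈ Metric.closedBall (x j) r := by
        by_contra h
        exact hzX ⟨hzΩ, fun h' => h (Set.mem_iUnion.1 h')⟩
      exact Set.mem_iUnion.2 ⟨j, le_antisymm hj (le_dist_of_mem_closure_diff hz j)⟩
    · exact Or.inl ⟨closure_mono Set.sdiff_subset hz, hzΩ⟩
  · rintro (⟨hz, hzΩ⟩ | hz)
    · refine ⟨?_, fun h => hzΩ h.1⟩
      rw [Set.sdiff_eq, Set.inter_comm]
      exact hB.isOpen_compl.inter_closure
        ⟨fun h => hzΩ (Set.iUnion_subset hballs h), hz⟩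
    · obtain ⟨j, hj⟩ := Set.mem_iUnion.1 hz
      have hjB := Metric.sphere_subset_closedBall hj
      refine ⟨?_, fun h => h.2 (Set.mem_iUnion.2 ⟨j, hjB⟩)⟩
      have hO : IsOpen (Ω \ ⋃ j' : {j' // j' ≠ j}, Metric.closedBall (x j') r) :=
        hΩ.sdiff (isClosed_iUnion_of_finite fun _ => Metric.isClosed_closedBall)
      have hzc : z ∈ closure (Metric.closedBall (x j) r)ᶜ := by
        rw [closure_compl, interior_closedBall _ hr.ne']
        intro h
        exact (Metric.mem_ball.1 h).ne hj
      refine closure_mono ?_ (hO.inter_closure ⟨⟨hballs j hjB, fun h => ?_⟩, hzc⟩)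
      · rintro w ⟨⟨hw1, hw2⟩, hw3⟩
        refine ⟨hw1, fun h => ?_⟩
        obtain ⟨i, hi⟩ := Set.mem_iUnion.1 h
        by_cases hij : i = j
        · exact hw3 (hij ▸ hi)
        · exact hw2 (Set.mem_iUnion.2 ⟨⟨i, hij⟩, hi⟩)
      · obtain ⟨⟨i, hi⟩, hzi⟩ := Set.mem_iUnion.1 h
        exact Set.disjoint_left.1 (hdisj i j hi) hzi hjB

lemma frontier_nonempty_of_isBounded (F : ConeSubequation n) {Ω : Set (EucSp n)}
    (hne : Ω.Nonempty) (hb : Bornology.IsBounded Ω) : (frontier Ω).Nonempty := by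
  have hn : n ≠ 0 := by
    rintro rfl
    obtain ⟨A, hA⟩ := F.nonempty'
    exact F.proper' (Set.eq_univ_of_forall fun B => Subsingleton.elim A B ▸ hA)
  have : Nonempty (Fin n) := ⟨⟨0, Nat.pos_of_ne_zero hn⟩⟩
  rw [Set.nonempty_iff_ne_empty, Ne, frontier_eq_empty_iff]
  rintro (h | h)
  · exact hne.ne_empty h
  · exact NormedSpace.unbounded_univ ℝ (EucSp n) (h ▸ hb)

/-- Theorem 6.1, the Dirichlet problem on the perforated domain: under (F3),
strict F-convexity of ∂Ω, and the barrier hypotheses (B2), (B4) on ψ, the Dirichlet problem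
on Ω_r = Ω ∖ ⋃_j B̄_r(x_j) with boundary values ψ on the inner spheres and φ on ∂Ω has a
solution H_r, and H_r is the Perron function of the corresponding family. -/
theorem dirichlet_singularities_stmt9 {n k : ℕ} (F : ConeSubequation n) (hF3 : CondF3 F)
    (Ω : Set (EucSp n)) (hΩ : IsBoundedDomain Ω) (hbdry : StrictlyConvexBoundary F Ω)
    (φ : EucSp n → ℝ) (hφ : ContinuousOn φ (frontier Ω))
    (x : Fin k → EucSp n) (hx : ∀ j, x j ∈ Ω)
    (ψ : EucSp n → EReal) (hψc : ContinuousOn ψ (closure Ω))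
    (hψtop : ∀ y ∈ closure Ω, ψ y ≠ ⊤)
    (hψsub : FSubharmonicOn F.carrier Ω ψ)
    (hψφ : ∀ y ∈ frontier Ω, ψ y ≤ (φ y : EReal))
    (hcase :
      (∀ y ∈ closure Ω, (ψ y = ⊥ ↔ ∃ j, y = x j)) ∨
      ((∀ y ∈ closure Ω, ψ y ≠ ⊥) ∧
        ∀ j, (∀ᶠ y in 𝓝[≠] (x j), ψ (x j) < ψ y) ∧ NoTestAt Ω ψ (x j)))
    (r : ℝ) (hr : 0 < r)
    (hballs : ∀ j, Metric.closedBall (x j) r ⊆ Ω)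
    (hdisj : ∀ j j', j ≠ j' →
      Disjoint (Metric.closedBall (x j) r) (Metric.closedBall (x j') r)) :
    ∃ H : EucSp n → ℝ,
      ContinuousOn H (closure (Ω \ ⋃ j, Metric.closedBall (x j) r)) ∧
      FHarmonicOn F (Ω \ ⋃ j, Metric.closedBall (x j) r) (fun y => (H y : EReal)) ∧
      (∀ j, ∀ y ∈ Metric.sphere (x j) r, (H y : EReal) = ψ y) ∧
      (∀ y ∈ frontier Ω, H y = φ y) ∧
      ∀ y ∈ closure (Ω \ ⋃ j, Metric.closedBall (x j) r),
        (H y : EReal) = ⨆ u ∈ {u : EucSp n → EReal |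
            UpperSemicontinuousOn u (closure (Ω \ ⋃ j, Metric.closedBall (x j) r)) ∧
            (∀ z ∈ closure (Ω \ ⋃ j, Metric.closedBall (x j) r), u z ≠ ⊤) ∧
            FSubharmonicOn F.carrier (Ω \ ⋃ j, Metric.closedBall (x j) r) u ∧
            (∀ j, ∀ z ∈ Metric.sphere (x j) r, u z ≤ ψ z) ∧
            (∀ z ∈ frontier Ω, u z ≤ (φ z : EReal))}, u y := by
  obtain ⟨hΩo, hΩc, hΩb⟩ := hΩ
  set X := Ω \ ⋃ j, Metric.closedBall (x j) r with hXdef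
  have hXΩ : X ⊆ Ω := Set.sdiff_subset
  have hXo : IsOpen X := hΩo.sdiff (isClosed_iUnion_closedBall x r)
  have hXb : Bornology.IsBounded X := hΩb.subset hXΩ
  have hclX : closure X ⊆ closure Ω := closure_mono hXΩ
  have hfr : frontier X = frontier Ω ∪ ⋃ j, Metric.sphere (x j) r :=
    frontier_diff_iUnion_closedBall hΩo hr hballs hdisj
  have hsphΩ : ∀ z ∈ ⋃ j, Metric.sphere (x j) r, z ∈ Ω := fun z hz => by
    obtain ⟨j, hj⟩ := Set.mem_iUnion.1 hz
    exact hballs j (Metric.sphere_subset_closedBall hj)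
  have hfrΩ : ∀ z ∈ frontier Ω, z ∉ Ω := fun z hz => (hΩo.frontier_eq ▸ hz).2
  have hψbot : ∀ z ∈ closure X, ψ z ≠ ⊥ := fun z hz => by
    rcases hcase with h | h
    · intro hbot
      obtain ⟨j, rfl⟩ := (h z (hclX hz)).1 hbot
      have := le_dist_of_mem_closure_diff hz j
      rw [dist_self] at this
      exact hr.not_ge this
    · exact h.1 z (hclX hz)
  have hψX : ContinuousOn ψ (closure X) := hψc.mono hclX
  set g : EucSp n → ℝ := fun z => if z ∈ frontier Ω then φ z else (ψ z).toReal with hg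
  have hgΩ : ∀ z ∈ frontier Ω, g z = φ z := fun z hz => if_pos hz
  have hgs : ∀ z ∈ ⋃ j, Metric.sphere (x j) r, g z = (ψ z).toReal := fun z hz =>
    if_neg fun h => hfrΩ z h (hsphΩ z hz)
  have hgψ : ∀ z ∈ ⋃ j, Metric.sphere (x j) r, (g z : EReal) = ψ z := fun z hz => by
    have hz' : z ∈ closure X := frontier_subset_closure (hfr ▸ Or.inr hz)
    rw [hgs z hz, EReal.coe_toReal (hψtop z (hclX hz')) (hψbot z hz')]
  have hgc : ContinuousOn g (frontier X) := by
    rw [hfr]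
    refine ContinuousOn.union_of_isClosed (hφ.congr hgΩ) (ContinuousOn.congr ?_ hgs)
      isClosed_frontier (isClosed_iUnion_of_finite fun _ => Metric.isClosed_sphere)
    have hsub : (⋃ j, Metric.sphere (x j) r) ⊆ closure X := fun z hz =>
      frontier_subset_closure (hfr ▸ Or.inr hz)
    refine EReal.continuousOn_toReal.comp (hψX.mono hsub) fun z hz => ?_
    simp [hψbot z (hsub hz), hψtop z (hclX (hsub hz))]
  obtain ⟨hψusc, -, hψat⟩ := (fSubharmonicOn_iff hΩo).1 hψsub
  have hψmem : ψ ∈ perronFamily F.carrier X g := by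
    refine ⟨hψX.upperSemicontinuousOn, fun z hz => hψtop z (hclX hz),
      fun z hz => hψat z (hXΩ hz), fun z hz => ?_⟩
    rw [hfr] at hz
    rcases hz with hz | hz
    · rw [hgΩ z hz]
      exact hψφ z hz
    · exact (hgψ z hz).ge
  obtain ⟨ρ, hρ, hΩρ, hconv⟩ := hbdry
  have hρ2 : ContDiff ℝ 2 ρ := hρ.of_le (WithTop.coe_le_coe.2 (le_top : (2 : ℕ∞) ≤ ⊤))
  have hρcl : ∀ z ∈ closure Ω, ρ z ≤ 0 := fun z hz => by
    refine closure_minimal (fun w hw => ?_) (isClosed_le hρ2.continuous continuous_const) hz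
    rw [hΩρ] at hw
    exact (show ρ w < 0 from hw).le
  have hρ0 : ∀ z ∈ frontier Ω, ρ z = 0 := fun z hz => by
    refine le_antisymm (hρcl z (frontier_subset_closure hz)) (not_lt.1 fun h => hfrΩ z hz ?_)
    rw [hΩρ]
    exact h
  have hext : ∀ y ∈ frontier X, ∃ c, y ≠ c ∧ ∀ z ∈ closure X, z ≠ y → ‖y - c‖ < ‖z - c‖ := by
    intro y hy
    rw [hfr] at hy
    rcases hy with hy | hy
    · obtain ⟨c, hc, h⟩ := exists_exterior_sphere_of_gradient hρ2.contDiffAt (hρ0 y hy)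
        (hconv y hy).1
      exact ⟨c, hc, fun z hz => h z (hρcl z (hclX hz))⟩
    · obtain ⟨j, hj⟩ := Set.mem_iUnion.1 hy
      obtain ⟨c, hc, h⟩ := exists_exterior_sphere_of_ball hr (mem_sphere_iff_norm.1 hj)
      exact ⟨c, hc, fun z hz => h z (dist_eq_norm z (x j) ▸ le_dist_of_mem_closure_diff hz j)⟩
  obtain ⟨H, hHc, hHsub, hHsuper, hHg, hHsup⟩ := exists_perron_solution (g := g) F.isClosed' F.f1
    hXo hXb (hfr ▸ (frontier_nonempty_of_isBounded F hΩc.nonempty hΩb).inl)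
    (fun y hy ε hε => by
      obtain ⟨c, hc, h⟩ := hext y hy
      exact exists_upperBarrier hF3 hXb hgc hc h hε)
    (fun y hy ε hε => by
      have hyX := frontier_subset_closure hy
      have hy' := hfr ▸ hy
      rcases hy' with hy' | hy'
      · obtain ⟨hN, t₀, ht₀⟩ := hconv y hy'
        obtain ⟨b, hb, hbF, hby, η, hη, hbρ⟩ :=
          exists_lowerBarrier F hρ2 (hρ0 y hy') hN (ht₀ t₀ le_rfl)
        exact exists_mem_perronFamily_of_lowerBarrier hXb hgc hψmem hψX hψbot hy hb hbF hby hη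
          (hbρ.mono fun z h hz => h (hρcl z (hclX hz))) hε
      · refine ⟨ψ, hψmem, eventually_nhdsWithin_iff.1 ?_⟩
        have hlt : ((g y - ε : ℝ) : EReal) < ψ y := by
          rw [← hgψ y hy', EReal.coe_lt_coe_iff]
          linarith
        exact ((hψX y hyX).eventually (lt_mem_nhds hlt)).mono fun z hz => hz.le)
    ⟨ψ, hψmem, hψbot⟩
  refine ⟨H, hHc, ⟨hHsub, hHsuper⟩, fun j y hy => ?_, fun y hy => ?_, fun y hy => ?_⟩
  · have hy' : y ∈ ⋃ j, Metric.sphere (x j) r := Set.mem_iUnion.2 ⟨j, hy⟩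
    rw [hHg y (hfr ▸ Or.inr hy'), hgψ y hy']
  · rw [hHg y (hfr ▸ Or.inl hy), hgΩ y hy]
  · rw [hHsup y hy]
    suffices h : perronFamily F.carrier X g = {u : EucSp n → EReal |
        UpperSemicontinuousOn u (closure X) ∧ (∀ z ∈ closure X, u z ≠ ⊤) ∧
        FSubharmonicOn F.carrier X u ∧ (∀ j, ∀ z ∈ Metric.sphere (x j) r, u z ≤ ψ z) ∧
        (∀ z ∈ frontier Ω, u z ≤ (φ z : EReal))} by rw [h]
    ext u
    rw [Set.mem_ofPred_eq, fSubharmonicOn_iff hXo]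
    constructor
    · rintro ⟨h1, h2, h3, h4⟩
      refine ⟨h1, h2, ⟨h1.mono subset_closure, fun z hz => h2 z (subset_closure hz), h3⟩,
        fun j z hz => ?_, fun z hz => ?_⟩
      · have hz' : z ∈ ⋃ j, Metric.sphere (x j) r := Set.mem_iUnion.2 ⟨j, hz⟩
        rw [← hgψ z hz']
        exact h4 z (hfr ▸ Or.inr hz')
      · rw [← hgΩ z hz]
        exact h4 z (hfr ▸ Or.inl hz)
    · rintro ⟨h1, h2, ⟨-, -, h3⟩, h4, h5⟩
      refine ⟨h1, h2, h3, fun z hz => ?_⟩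
      rw [hfr] at hz
      rcases hz with hz | hz
      · rw [hgΩ z hz]
        exact h5 z hz
      · obtain ⟨j, hj⟩ := Set.mem_iUnion.1 hz
        rw [hgψ z hz]
        exact h4 j z hj
end
end
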